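/- arXiv:1202.2092 — 2 statements merged into one kernel-verified Lean document; each statement's English description precedes it below -/
import Mathlib

section
/- There exist constants c > 0 and c' > 0 such that the following holds. Let G₀ be a connected simple graph on n ≥ 2 vertices whose edge set has k ≥ 2 fewer edges than the complete graph on the same vertex set. Then the probability that the two-hop walk process started at G₀ reaches the complete graph within ⌊c·n·ln k⌋ rounds is at most c'·e^{−k^{1/4}}. -/
open scoped Classical

noncomputable section

variable {V : Type} [Fintype V] [DecidableEq V]

/-- The neighbors of `v` in `G`, as a `Finset`. -/
def nbr (G : SimpleGraph V) (v : V) : Finset V := Finset.univ.filter (fun w => G.Adj v w)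

/-- The degree `d(v)` of `v` in `G`. -/
def deg (G : SimpleGraph V) (v : V) : ℕ := (nbr G v).card

/-- The minimum degree of `G`. -/
def minDeg (G : SimpleGraph V) : ℕ := sInf (Set.range (deg G))

/-- `Nk G u i` is the set `Nⁱ(u)` of vertices at graph distance exactly `i` from `u`. -/
def Nk (G : SimpleGraph V) (u : V) (i : ℕ) : Finset V :=
  Finset.univ.filter (fun v => v ≠ u ∧ G.dist u v = i)

/-- `degIn G v S` is `d(v, S)`, the number of neighbors of `v` lying in `S`. -/
def degIn (G : SimpleGraph V) (v : V) (S : Finset V) : ℕ := (nbr G v ∩ S).card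

/-- The graph obtained from a choice function `c` in one round of the triangulation
process: every vertex `w` adds the edge joining the ordered pair `c w` of its chosen
neighbors (edges are unordered, loops are discarded, all additions are simultaneous). -/
def triNext (G : SimpleGraph V) (c : V → V × V) : SimpleGraph V :=
  G ⊔ SimpleGraph.fromEdgeSet {e | ∃ v : V, e = s((c v).1, (c v).2)}

/-- The probability that in one round of the triangulation process on the current
graph `G` the vertices make exactly the choices recorded by `c`: each vertex with at
least one neighbor independently picks an ordered pair of its neighbors uniformly at
random with replacement; isolated vertices are given the dummy choice `(v, v)`. -/
def triWeight (G : SimpleGraph V) (c : V → V × V) : ℝ :=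
  ∏ v : V,
    if deg G v = 0 then (if c v = (v, v) then 1 else 0)
    else if (c v).1 ∈ nbr G v ∧ (c v).2 ∈ nbr G v then (1 : ℝ) / (deg G v : ℝ) ^ 2 else 0

/-- Transition probability of one round of the triangulation process. -/
def triStep (G G' : SimpleGraph V) : ℝ :=
  ∑ c : V → V × V, if triNext G c = G' then triWeight G c else 0

/-- The graph obtained from a choice function `c` in one round of the two-hop walk
process: every vertex `u` adds the edge to the endpoint `(c u).2` of its two-hop walk
(loops are discarded, all additions are simultaneous). -/
def hopNext (G : SimpleGraph V) (c : V → V × V) : SimpleGraph V :=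
  G ⊔ SimpleGraph.fromEdgeSet {e | ∃ u : V, e = s(u, (c u).2)}

/-- The probability that in one round of the two-hop walk process on the current graph
`G` the vertices make exactly the choices recorded by `c`: each vertex `u` with at
least one neighbor independently picks a uniformly random neighbor `v = (c u).1` and
then a uniformly random neighbor `w = (c u).2` of `v`; isolated vertices are given the
dummy choice `(u, u)`. -/
def hopWeight (G : SimpleGraph V) (c : V → V × V) : ℝ :=
  ∏ u : V,
    if deg G u = 0 then (if c u = (u, u) then 1 else 0)
    else if (c u).1 ∈ nbr G u ∧ (c u).2 ∈ nbr G (c u).1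
      then (1 : ℝ) / ((deg G u : ℝ) * (deg G (c u).1 : ℝ)) else 0

/-- Transition probability of one round of the two-hop walk process. -/
def hopStep (G G' : SimpleGraph V) : ℝ :=
  ∑ c : V → V × V, if hopNext G c = G' then hopWeight G c else 0

/-- `trajProb step g0 T E` is the probability, for the Markov chain on a finite state
space `Γ` with one-step transition probabilities `step` started at `g0`, that the
trajectory `(g_0, g_1, …, g_T)` satisfies the event `E`; probabilities are realized as
a probability mass function on finite sequences of states.  (The trajectory is passed
to `E` as a function on `ℕ`, frozen at time `T`.) -/
def trajProb {Γ : Type} [Fintype Γ] (step : Γ → Γ → ℝ) (g0 : Γ) (T : ℕ)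
    (E : (ℕ → Γ) → Prop) : ℝ :=
  ∑ s : Fin (T + 1) → Γ,
    if s 0 = g0 ∧ E (fun t => s ⟨min t T, Nat.lt_succ_of_le (Nat.min_le_right t T)⟩)
    then ∏ t : Fin T, step (s t.castSucc) (s t.succ) else 0

end

namespace TwoHop

section Trajectory

variable {Γ : Type} [Fintype Γ]

/-- The probability that the chain started at `g` hits `a` within `T` rounds. -/
noncomputable def hitProb (step : Γ → Γ → ℝ) (a g : Γ) (T : ℕ) : ℝ :=
  ∑ s : Fin (T + 1) → Γ,
    if s 0 = g ∧ ∃ i, s i = a then ∏ t : Fin T, step (s t.castSucc) (s t.succ) else 0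

lemma trajProb_eq_hitProb (step : Γ → Γ → ℝ) (a g : Γ) (T : ℕ) :
    trajProb step g T (fun x => ∃ t ≤ T, x t = a) = hitProb step a g T := by
  unfold trajProb hitProb
  refine Finset.sum_congr rfl fun s _ => ?_
  have h : (∃ t ≤ T, s ⟨min t T, Nat.lt_succ_of_le (Nat.min_le_right t T)⟩ = a) ↔
      ∃ i, s i = a := by
    constructor
    · rintro ⟨t, -, h⟩
      exact ⟨_, h⟩
    · rintro ⟨i, h⟩
      refine ⟨i, Nat.lt_succ_iff.mp i.2, ?_⟩
      convert h using 2
      ext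
      simp [Nat.lt_succ_iff.mp i.2]
  simp only [h]

lemma sum_paths_succ (step : Γ → Γ → ℝ) (g : Γ) (T : ℕ) (E : (Fin (T + 2) → Γ) → Prop)
    [DecidablePred E] :
    (∑ s : Fin (T + 2) → Γ,
      if s 0 = g ∧ E s then ∏ t : Fin (T + 1), step (s t.castSucc) (s t.succ) else 0) =
    ∑ g', step g g' * ∑ s : Fin (T + 1) → Γ,
      if s 0 = g' ∧ E (Fin.cons g s) then ∏ t : Fin T, step (s t.castSucc) (s t.succ) else 0 := by
  rw [← (Fin.consEquiv fun _ : Fin (T + 2) => Γ).sum_comp, Fintype.sum_prod_type]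
  simp_rw [Finset.mul_sum]
  rw [Finset.sum_comm, Finset.sum_comm (s := (Finset.univ : Finset Γ))]
  refine Finset.sum_congr rfl fun s _ => ?_
  have h1 : ∀ x : Γ, x ≠ g → (if (Fin.consEquiv fun _ : Fin (T + 2) => Γ) (x, s) 0 = g ∧
      E ((Fin.consEquiv fun _ : Fin (T + 2) => Γ) (x, s)) then
      ∏ t : Fin (T + 1), step ((Fin.consEquiv fun _ : Fin (T + 2) => Γ) (x, s) t.castSucc)
        ((Fin.consEquiv fun _ : Fin (T + 2) => Γ) (x, s) t.succ) else 0) = 0 := by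
    intro x hx
    simp [Fin.consEquiv, hx]
  have h2 : ∀ x : Γ, x ≠ s 0 → (step g x * if s 0 = x ∧ E (Fin.cons g s) then
      ∏ t : Fin T, step (s t.castSucc) (s t.succ) else 0) = 0 := by
    intro x hx
    simp [hx.symm]
  rw [Fintype.sum_eq_single g h1, Fintype.sum_eq_single (s 0) h2]
  simp [Fin.consEquiv, Fin.prod_univ_succ]

variable {step : Γ → Γ → ℝ}

lemma sum_paths_eq_one (hstep : ∀ g, ∑ g', step g g' = 1) (g : Γ) (T : ℕ) :
    (∑ s : Fin (T + 1) → Γ,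
      if s 0 = g ∧ True then ∏ t : Fin T, step (s t.castSucc) (s t.succ) else 0) = 1 := by
  induction T generalizing g with
  | zero =>
    rw [Fintype.sum_eq_single (fun _ => g)]
    · simp
    · intro s hs
      have : s 0 ≠ g := fun h => hs (funext fun i => by rw [Fin.eq_zero i, h])
      simp [this]
  | succ T ih =>
    rw [sum_paths_succ step g T (fun _ => True)]
    simp only [ih, mul_one, hstep]

lemma hitProb_le_one (h0 : ∀ g g', 0 ≤ step g g') (hstep : ∀ g, ∑ g', step g g' = 1)
    (a g : Γ) (T : ℕ) : hitProb step a g T ≤ 1 := by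
  rw [← sum_paths_eq_one hstep g T]
  unfold hitProb
  refine Finset.sum_le_sum fun s _ => ?_
  have hp : 0 ≤ ∏ t : Fin T, step (s t.castSucc) (s t.succ) :=
    Finset.prod_nonneg fun _ _ => h0 _ _
  split_ifs <;> simp_all

lemma hitProb_zero {a g : Γ} (h : g ≠ a) : hitProb step a g 0 = 0 := by
  refine Finset.sum_eq_zero fun s _ => if_neg ?_
  rintro ⟨h1, i, h2⟩
  rw [Fin.eq_zero i, h1] at h2
  exact h h2

lemma hitProb_succ {a g : Γ} (h : g ≠ a) (T : ℕ) :
    hitProb step a g (T + 1) = ∑ g', step g g' * hitProb step a g' T := by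
  unfold hitProb
  rw [sum_paths_succ step g T (fun s => ∃ i, s i = a)]
  simp [Fin.exists_fin_succ, h]

end Trajectory

section Round

variable {V : Type} [Fintype V] [DecidableEq V]

/-- The probability that vertex `u` makes the choice `p` in one round from `G`. -/
noncomputable def choiceProb (G : SimpleGraph V) (u : V) (p : V × V) : ℝ :=
  if deg G u = 0 then (if p = (u, u) then 1 else 0)
  else if p.1 ∈ nbr G u ∧ p.2 ∈ nbr G p.1
    then (1 : ℝ) / ((deg G u : ℝ) * (deg G p.1 : ℝ)) else 0

lemma mem_nbr {G : SimpleGraph V} {u v : V} : v ∈ nbr G u ↔ G.Adj u v := by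
  simp [nbr]

lemma deg_mono {G H : SimpleGraph V} (h : G ≤ H) (v : V) : deg G v ≤ deg H v :=
  Finset.card_le_card fun _ hw => mem_nbr.mpr (h (mem_nbr.mp hw))

lemma deg_pos_of_adj {G : SimpleGraph V} {u v : V} (h : G.Adj u v) : 0 < deg G v :=
  Finset.card_pos.mpr ⟨u, mem_nbr.mpr h.symm⟩

lemma hopWeight_eq_prod (G : SimpleGraph V) (c : V → V × V) :
    hopWeight G c = ∏ u, choiceProb G u (c u) := rfl

lemma choiceProb_nonneg (G : SimpleGraph V) (u : V) (p : V × V) : 0 ≤ choiceProb G u p := by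
  unfold choiceProb
  split_ifs <;> positivity

lemma hopWeight_nonneg (G : SimpleGraph V) (c : V → V × V) : 0 ≤ hopWeight G c :=
  Finset.prod_nonneg fun _ _ => choiceProb_nonneg _ _ _

lemma sum_choiceProb_mul (G : SimpleGraph V) {u : V} (hu : deg G u ≠ 0) (f : V → ℝ) :
    ∑ p : V × V, choiceProb G u p * f p.2 =
      ∑ v ∈ nbr G u, 1 / (deg G u : ℝ) * ∑ w ∈ nbr G v, 1 / (deg G v : ℝ) * f w := by
  rw [Fintype.sum_prod_type, ← Finset.sum_subset (Finset.subset_univ (nbr G u))]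
  · refine Finset.sum_congr rfl fun v hv => ?_
    rw [← Finset.sum_subset (Finset.subset_univ (nbr G v)), Finset.mul_sum]
    · refine Finset.sum_congr rfl fun w hw => ?_
      simp only [choiceProb, hu, hv, hw, if_false, and_self, if_true]
      rw [← mul_assoc, one_div_mul_one_div]
    · intro w _ hw
      simp [choiceProb, hu, hw]
  · intro v _ hv
    simp [choiceProb, hu, hv]

lemma sum_choiceProb (G : SimpleGraph V) (u : V) : ∑ p, choiceProb G u p = 1 := by
  by_cases hu : deg G u = 0
  · simp [choiceProb, hu]
  have h := sum_choiceProb_mul G hu (fun _ => 1)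
  simp only [mul_one] at h
  rw [h]
  have h2 : ∀ v ∈ nbr G u, 1 / (deg G u : ℝ) * ∑ w ∈ nbr G v, 1 / (deg G v : ℝ) =
      1 / (deg G u : ℝ) := by
    intro v hv
    have : (deg G v : ℝ) ≠ 0 := by
      exact_mod_cast (deg_pos_of_adj (mem_nbr.mp hv)).ne'
    rw [Finset.sum_const, nsmul_eq_mul]
    change _ * ((deg G v : ℝ) * _) = _
    field_simp
  rw [Finset.sum_congr rfl h2, Finset.sum_const, nsmul_eq_mul]
  change (deg G u : ℝ) * _ = 1
  have : (deg G u : ℝ) ≠ 0 := by exact_mod_cast hu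
  field_simp

/-- The probability that the two-hop walk from `u` ends in `K`. -/
noncomputable def endProb (G : SimpleGraph V) (u : V) (K : Finset V) : ℝ :=
  ∑ p : V × V, choiceProb G u p * (if p.2 ∈ K then 1 else 0)

lemma endProb_le (G : SimpleGraph V) (u : V) (K : Finset V) (huK : u ∉ K) {δ : ℝ} (hδ : 0 ≤ δ)
    (h : ∀ v, G.Adj u v → ∀ w ∈ K, G.Adj v w → 1 / (deg G v : ℝ) ≤ δ) :
    endProb G u K ≤ K.card * δ := by
  by_cases hu : deg G u = 0
  · have h0 : endProb G u K = 0 := by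
      refine Finset.sum_eq_zero fun p _ => ?_
      by_cases hp : p = (u, u)
      · simp [hp, huK]
      · simp [choiceProb, hu, hp]
    rw [h0]
    positivity
  rw [endProb, sum_choiceProb_mul G hu (fun w => if w ∈ K then 1 else 0)]
  have hinner : ∀ v ∈ nbr G u, 1 / (deg G u : ℝ) * ∑ w ∈ nbr G v, 1 / (deg G v : ℝ) *
      (if w ∈ K then 1 else 0) ≤ 1 / (deg G u : ℝ) * (K.card * δ) := by
    intro v hv
    refine mul_le_mul_of_nonneg_left ?_ (by positivity)
    simp only [mul_ite, mul_one, mul_zero]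
    rw [← Finset.sum_filter]
    calc ∑ w ∈ nbr G v with w ∈ K, 1 / (deg G v : ℝ)
        ≤ ∑ w ∈ nbr G v with w ∈ K, δ := by
          refine Finset.sum_le_sum fun w hw => ?_
          rw [Finset.mem_filter, mem_nbr] at hw
          exact h v (mem_nbr.mp hv) w hw.2 hw.1
      _ = ((nbr G v).filter (· ∈ K)).card * δ := by rw [Finset.sum_const, nsmul_eq_mul]
      _ ≤ K.card * δ := by
          refine mul_le_mul_of_nonneg_right ?_ hδ
          exact_mod_cast Finset.card_le_card fun w hw => (Finset.mem_filter.mp hw).2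
  refine (Finset.sum_le_sum hinner).trans (le_of_eq ?_)
  rw [Finset.sum_const, nsmul_eq_mul]
  change (deg G u : ℝ) * _ = _
  have : (deg G u : ℝ) ≠ 0 := by exact_mod_cast hu
  field_simp

lemma sum_prod_choices (f : V → V × V → ℝ) :
    ∑ c : V → V × V, ∏ u, f u (c u) = ∏ u, ∑ p, f u p := by
  rw [Finset.prod_univ_sum, Fintype.piFinset_univ]

lemma sum_hopWeight (G : SimpleGraph V) : ∑ c, hopWeight G c = 1 := by
  simp_rw [hopWeight_eq_prod, sum_prod_choices, sum_choiceProb, Finset.prod_const_one]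

lemma hopStep_nonneg (G G' : SimpleGraph V) : 0 ≤ hopStep G G' := by
  refine Finset.sum_nonneg fun c _ => ?_
  split_ifs
  exacts [hopWeight_nonneg G c, le_rfl]

lemma sum_hopStep_mul (G : SimpleGraph V) (F : SimpleGraph V → ℝ) :
    ∑ G', hopStep G G' * F G' = ∑ c, hopWeight G c * F (hopNext G c) := by
  simp_rw [hopStep, Finset.sum_mul]
  rw [Finset.sum_comm]
  refine Finset.sum_congr rfl fun c _ => ?_
  simp [ite_mul]

lemma sum_hopStep (G : SimpleGraph V) : ∑ G', hopStep G G' = 1 := by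
  have := sum_hopStep_mul G (fun _ => 1)
  simpa [sum_hopWeight] using this

lemma le_hopNext (G : SimpleGraph V) (c : V → V × V) : G ≤ hopNext G c := le_sup_left

lemma hopNext_adj {G : SimpleGraph V} {c : V → V × V} {x y : V} (h : (hopNext G c).Adj x y)
    (hG : ¬ G.Adj x y) : (c x).2 = y ∨ (c y).2 = x := by
  simp only [hopNext, SimpleGraph.sup_adj, SimpleGraph.fromEdgeSet_adj, Set.mem_ofPred_eq,
    hG, false_or] at h
  obtain ⟨⟨u, hu⟩, -⟩ := h
  rw [Sym2.eq_iff] at hu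
  rcases hu with ⟨rfl, h⟩ | ⟨h, rfl⟩
  · exact Or.inl h.symm
  · exact Or.inr h.symm

/-- The probability of being complete within `t` rounds. -/
noncomputable abbrev completeProb (G : SimpleGraph V) (t : ℕ) : ℝ :=
  hitProb hopStep (⊤ : SimpleGraph V) G t

lemma completeProb_le_one (G : SimpleGraph V) (t : ℕ) : completeProb G t ≤ 1 :=
  hitProb_le_one hopStep_nonneg sum_hopStep _ _ _

lemma completeProb_succ {G : SimpleGraph V} (h : G ≠ ⊤) (t : ℕ) :
    completeProb G (t + 1) = ∑ c, hopWeight G c * completeProb (hopNext G c) t := by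
  rw [completeProb, hitProb_succ h, sum_hopStep_mul]

lemma exp_two_mul_sub_one_le {θ : ℝ} (h0 : 0 ≤ θ) (h1 : θ ≤ 1) :
    Real.exp (2 * θ) - 1 ≤ 8 * θ := by
  have h := convexOn_exp.2 (Set.mem_univ (0 : ℝ)) (Set.mem_univ (2 : ℝ))
    (by linarith : 0 ≤ 1 - θ) h0 (by ring)
  simp only [smul_eq_mul, mul_zero, zero_add, Real.exp_zero, mul_one] at h
  rw [mul_comm θ 2] at h
  have he : Real.exp 2 ≤ 9 := by
    have h2 : Real.exp 2 = Real.exp 1 * Real.exp 1 := by rw [← Real.exp_add]; norm_num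
    rw [h2]
    nlinarith [Real.exp_one_lt_d9, Real.exp_pos 1]
  nlinarith

/-- If the two-hop walk ends decrease `Φ` by at most `2` each, the exponential moment of `Φ`
contracts. -/
lemma sum_hopWeight_mul_exp_le (G : SimpleGraph V) (Φ : SimpleGraph V → ℕ) (K : V → Finset V)
    {q θ : ℝ} (h0 : 0 ≤ θ) (h1 : θ ≤ 1)
    (hΦ : ∀ c, Φ G ≤ Φ (hopNext G c) + 2 * (Finset.univ.filter fun u => (c u).2 ∈ K u).card)
    (hK : ∑ u, endProb G u (K u) ≤ q * Φ G) :
    ∑ c, hopWeight G c * Real.exp (-(θ * Φ (hopNext G c))) ≤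
      Real.exp (-(θ * (1 - 8 * q) * Φ G)) := by
  set b : ℝ := Real.exp (2 * θ) - 1 with hb
  have hb0 : 0 ≤ b := by
    rw [hb, sub_nonneg]
    exact Real.one_le_exp (by positivity)
  have hend0 : ∀ u, 0 ≤ endProb G u (K u) := fun u =>
    Finset.sum_nonneg fun p _ => mul_nonneg (choiceProb_nonneg _ _ _) (by split_ifs <;> norm_num)
  have hfactor : ∀ u, ∑ p : V × V, choiceProb G u p * (1 + b * if p.2 ∈ K u then 1 else 0) =
      1 + b * endProb G u (K u) := by
    intro u
    simp_rw [mul_add, mul_one, Finset.sum_add_distrib, sum_choiceProb, endProb, Finset.mul_sum]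
    congr 1
    exact Finset.sum_congr rfl fun p _ => by ring
  have hpoint : ∀ c : V → V × V, Real.exp (-(θ * Φ (hopNext G c))) ≤
      Real.exp (-(θ * Φ G)) * ∏ u, (1 + b * if (c u).2 ∈ K u then 1 else 0) := by
    intro c
    have hprod : ∏ u, (1 + b * if (c u).2 ∈ K u then (1 : ℝ) else 0) =
        Real.exp (2 * θ * (Finset.univ.filter fun u => (c u).2 ∈ K u).card) := by
      have : ∀ u, (1 + b * if (c u).2 ∈ K u then (1 : ℝ) else 0) =
          if (c u).2 ∈ K u then Real.exp (2 * θ) else 1 := by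
        intro u
        split_ifs <;> simp [hb]
      simp_rw [this]
      rw [Finset.prod_ite, Finset.prod_const, Finset.prod_const_one, mul_one, ← Real.exp_nat_mul]
      ring_nf
    rw [hprod, ← Real.exp_add]
    refine Real.exp_le_exp.mpr ?_
    have : (Φ G : ℝ) ≤ Φ (hopNext G c) +
        2 * (Finset.univ.filter fun u => (c u).2 ∈ K u).card := by exact_mod_cast hΦ c
    nlinarith
  calc ∑ c, hopWeight G c * Real.exp (-(θ * Φ (hopNext G c)))
      ≤ ∑ c, hopWeight G c * (Real.exp (-(θ * Φ G)) *
          ∏ u, (1 + b * if (c u).2 ∈ K u then 1 else 0)) :=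
        Finset.sum_le_sum fun c _ => mul_le_mul_of_nonneg_left (hpoint c) (hopWeight_nonneg G c)
    _ = Real.exp (-(θ * Φ G)) * ∏ u, (1 + b * endProb G u (K u)) := by
        simp_rw [← hfactor]
        rw [← sum_prod_choices, Finset.mul_sum]
        refine Finset.sum_congr rfl fun c _ => ?_
        rw [hopWeight_eq_prod, Finset.prod_mul_distrib]
        ring
    _ ≤ Real.exp (-(θ * Φ G)) * ∏ u, Real.exp (b * endProb G u (K u)) := by
        refine mul_le_mul_of_nonneg_left ?_ (Real.exp_pos _).le
        refine Finset.prod_le_prod (fun u _ => ?_) fun u _ => ?_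
        · have := mul_nonneg hb0 (hend0 u)
          linarith
        · linarith [Real.add_one_le_exp (b * endProb G u (K u))]
    _ = Real.exp (-(θ * Φ G) + b * ∑ u, endProb G u (K u)) := by
        rw [← Real.exp_sum, ← Real.exp_add, Finset.mul_sum]
    _ ≤ Real.exp (-(θ * (1 - 8 * q) * Φ G)) := by
        refine Real.exp_le_exp.mpr ?_
        have hs : 0 ≤ ∑ u, endProb G u (K u) := Finset.sum_nonneg fun u _ => hend0 u
        have h2 : b * ∑ u, endProb G u (K u) ≤ 8 * θ * (q * Φ G) :=
          mul_le_mul (exp_two_mul_sub_one_le h0 h1) hK hs (by positivity)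
        linarith

lemma completeProb_le_of_potential (G₀ : SimpleGraph V) (Φ : SimpleGraph V → ℕ)
    (K : SimpleGraph V → V → Finset V) {q : ℝ} (hq0 : 0 ≤ q) (hq1 : 8 * q ≤ 1)
    (htop : Φ ⊤ = 0)
    (hΦ : ∀ G, G₀ ≤ G → ∀ c, Φ G ≤ Φ (hopNext G c) +
      2 * (Finset.univ.filter fun u => (c u).2 ∈ K G u).card)
    (hK : ∀ G, G₀ ≤ G → ∑ u, endProb G u (K G u) ≤ q * Φ G) (t : ℕ) :
    completeProb G₀ t ≤ Real.exp (-((1 - 8 * q) ^ t * Φ G₀)) := by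
  suffices h : ∀ G, G₀ ≤ G → completeProb G t ≤ Real.exp (-((1 - 8 * q) ^ t * Φ G)) from
    h G₀ le_rfl
  induction t with
  | zero =>
    intro G _
    by_cases hG : G = ⊤
    · subst hG
      simpa [htop] using completeProb_le_one (⊤ : SimpleGraph V) 0
    · rw [completeProb, hitProb_zero hG]
      exact (Real.exp_pos _).le
  | succ t ih =>
    intro G hle
    by_cases hG : G = ⊤
    · subst hG
      simpa [htop] using completeProb_le_one (⊤ : SimpleGraph V) (t + 1)
    rw [completeProb_succ hG, pow_succ]
    refine le_trans (Finset.sum_le_sum fun c _ => ?_)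
      (sum_hopWeight_mul_exp_le G Φ (K G) (q := q) (pow_nonneg (by linarith) t)
        (pow_le_one₀ (by linarith) (by linarith)) (hΦ G hle) (hK G hle))
    exact mul_le_mul_of_nonneg_left (ih _ (hle.trans (le_hopNext G c))) (hopWeight_nonneg G c)

/-- The vertices distinct from and not adjacent to `u`. -/
noncomputable def nonNbr (G : SimpleGraph V) (u : V) : Finset V :=
  Finset.univ.filter fun w => u ≠ w ∧ ¬ G.Adj u w

/-- The ordered pairs of distinct nonadjacent vertices. -/
noncomputable def missingPairs (G : SimpleGraph V) : Finset (V × V) :=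
  Finset.univ.filter fun p => p.1 ≠ p.2 ∧ ¬ G.Adj p.1 p.2

lemma missingPairs_top : missingPairs (⊤ : SimpleGraph V) = ∅ := by
  ext p
  simp [missingPairs]

lemma card_missingPairs (G : SimpleGraph V) :
    (missingPairs G).card = ∑ u, (nonNbr G u).card := by
  simp only [missingPairs, nonNbr, Finset.card_filter, Fintype.sum_prod_type]

lemma card_nonNbr (G : SimpleGraph V) (u : V) :
    (nonNbr G u).card + deg G u + 1 = Fintype.card V := by
  have h1 : nonNbr G u = (insert u (nbr G u))ᶜ := by
    ext w
    simp [nonNbr, mem_nbr, eq_comm]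
  have h2 : (insert u (nbr G u)).card = deg G u + 1 :=
    Finset.card_insert_of_notMem (by simp [mem_nbr])
  rw [h1, add_assoc, ← h2, Finset.card_compl_add_card]

lemma card_missingPairs_eq (G : SimpleGraph V) {k : ℕ}
    (hk : (Finset.univ.filter (fun e : Sym2 V => e ∈ G.edgeSet)).card + k =
      Nat.choose (Fintype.card V) 2) : (missingPairs G).card = 2 * k := by
  have h1 : ∑ u, deg G u = 2 * (Finset.univ.filter (fun e : Sym2 V => e ∈ G.edgeSet)).card := by
    have h := G.sum_degrees_eq_twice_card_edges
    have h2 : G.edgeFinset = Finset.univ.filter (fun e : Sym2 V => e ∈ G.edgeSet) := by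
      ext e
      simp
    rw [h2] at h
    rw [← h]
    refine Finset.sum_congr rfl fun u _ => ?_
    rw [deg, SimpleGraph.degree]
    congr 1
    ext w
    simp [mem_nbr]
  have h3 : (missingPairs G).card + ∑ u, deg G u + Fintype.card V =
      Fintype.card V * Fintype.card V := by
    rw [card_missingPairs, ← Finset.sum_add_distrib]
    have : ∑ u, ((nonNbr G u).card + deg G u + 1) = Fintype.card V * Fintype.card V := by
      simp [card_nonNbr]
    rwa [Finset.sum_add_distrib, Finset.sum_const, Finset.card_univ, smul_eq_mul, mul_one] at this
  have h4 : Nat.choose (Fintype.card V) 2 * 2 + Fintype.card V =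
      Fintype.card V * Fintype.card V := by
    rw [Nat.choose_two_right,
      Nat.div_mul_cancel (Nat.even_mul_pred_self (Fintype.card V)).two_dvd]
    rcases Nat.eq_zero_or_pos (Fintype.card V) with h | h
    · simp [h]
    · obtain ⟨m, hm⟩ := Nat.exists_eq_succ_of_ne_zero h.ne'
      rw [hm, Nat.succ_sub_one]
      simp only [Nat.succ_eq_add_one]
      ring
  omega

lemma card_missingPairs_le_hopNext (G : SimpleGraph V) (c : V → V × V) :
    (missingPairs G).card ≤ (missingPairs (hopNext G c)).card +
      2 * (Finset.univ.filter fun u => (c u).2 ∈ nonNbr G u).card := by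
  set B := Finset.univ.filter fun u => (c u).2 ∈ nonNbr G u with hB
  have hsub : missingPairs G ⊆ missingPairs (hopNext G c) ∪
      (B.image (fun u => (u, (c u).2)) ∪ B.image (fun u => ((c u).2, u))) := by
    rintro ⟨x, y⟩ hp
    simp only [missingPairs, Finset.mem_filter, Finset.mem_univ, true_and] at hp
    by_cases h : (hopNext G c).Adj x y
    · rcases hopNext_adj h hp.2 with h1 | h1
      · refine Finset.mem_union_right _ (Finset.mem_union_left _ ?_)
        refine Finset.mem_image.mpr ⟨x, ?_, by rw [h1]⟩
        simp [hB, nonNbr, h1, hp]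
      · refine Finset.mem_union_right _ (Finset.mem_union_right _ ?_)
        refine Finset.mem_image.mpr ⟨y, ?_, by rw [h1]⟩
        simp [hB, nonNbr, h1, hp.1.symm, G.adj_comm y x, hp.2]
    · refine Finset.mem_union_left _ ?_
      simp [missingPairs, hp.1, h]
  have h1 := Finset.card_le_card hsub
  have h2 := Finset.card_union_le (missingPairs (hopNext G c))
    (B.image (fun u => (u, (c u).2)) ∪ B.image (fun u => ((c u).2, u)))
  have h3 := Finset.card_union_le (B.image (fun u => (u, (c u).2)))
    (B.image (fun u => ((c u).2, u)))
  have h4 := Finset.card_image_le (s := B) (f := fun u => (u, (c u).2))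
  have h5 := Finset.card_image_le (s := B) (f := fun u => ((c u).2, u))
  omega

lemma one_div_deg_le {G₀ G : SimpleGraph V} (h : G₀ ≤ G) {n : ℕ} (hn : 0 < n) {v : V}
    (hv : n ≤ 16 * deg G₀ v) : 1 / (deg G v : ℝ) ≤ 16 / n := by
  have h1 : (n : ℝ) ≤ 16 * deg G v := by
    exact_mod_cast hv.trans (Nat.mul_le_mul_left 16 (deg_mono h v))
  have hn' : (0 : ℝ) < n := by exact_mod_cast hn
  rw [div_le_div_iff₀ (by linarith) hn']
  linarith

lemma completeProb_le_of_minDeg (G₀ : SimpleGraph V) {n : ℕ} (hn : 1024 ≤ n)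
    (hdeg : ∀ v, n ≤ 16 * deg G₀ v) (t : ℕ) :
    completeProb G₀ t ≤ Real.exp (-((1 - 1024 / n) ^ t * (missingPairs G₀).card)) := by
  have hn' : (1024 : ℝ) ≤ n := by exact_mod_cast hn
  have hq : 8 * (128 / (n : ℝ)) = 1024 / n := by ring
  have := completeProb_le_of_potential G₀ (fun G => (missingPairs G).card) nonNbr
    (q := 128 / n) (by positivity) (by rw [hq, div_le_one (by linarith)]; exact hn')
    (by simp [missingPairs_top]) (fun G _ c => card_missingPairs_le_hopNext G c) ?_ t
  · rwa [hq] at this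
  intro G hG
  rw [card_missingPairs, Nat.cast_sum, Finset.mul_sum]
  refine Finset.sum_le_sum fun u _ => ?_
  refine (endProb_le G u (nonNbr G u) (by simp [nonNbr]) (δ := 16 / n) (by positivity)
    fun v _ w _ _ => one_div_deg_le hG (by omega) (hdeg v)).trans ?_
  rw [mul_comm]
  gcongr
  norm_num

/-- The vertices outside `L` with no neighbor in `L`. -/
noncomputable def farFrom (G : SimpleGraph V) (L : Finset V) : Finset V :=
  Finset.univ.filter fun w => w ∉ L ∧ ∀ v ∈ L, ¬ G.Adj v w

/-- The walk ends that join a vertex of `L` with one of `farFrom G L`. -/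
noncomputable def joiningEnds (G : SimpleGraph V) (L : Finset V) (u : V) : Finset V :=
  if u ∈ L then farFrom G L else if u ∈ farFrom G L then L else ∅

lemma card_farFrom_le_hopNext (G : SimpleGraph V) (L : Finset V) (c : V → V × V) :
    (farFrom G L).card ≤ (farFrom (hopNext G c) L).card +
      2 * (Finset.univ.filter fun u => (c u).2 ∈ joiningEnds G L u).card := by
  set B := Finset.univ.filter fun u => (c u).2 ∈ joiningEnds G L u with hB
  have hsub : farFrom G L ⊆ farFrom (hopNext G c) L ∪ (B ∪ B.image (fun u => (c u).2)) := by
    intro w hw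
    by_cases hw' : w ∈ farFrom (hopNext G c) L
    · exact Finset.mem_union_left _ hw'
    refine Finset.mem_union_right _ ?_
    have hw2 := hw
    simp only [farFrom, Finset.mem_filter, Finset.mem_univ, true_and] at hw2 hw'
    obtain ⟨hwL, hadj⟩ := hw2
    push Not at hw'
    obtain ⟨v, hv, hvw⟩ := hw' hwL
    rcases hopNext_adj hvw (hadj v hv) with h1 | h1
    · refine Finset.mem_union_right _ (Finset.mem_image.mpr ⟨v, ?_, h1⟩)
      exact Finset.mem_filter.mpr ⟨Finset.mem_univ v, by simpa [joiningEnds, hv, h1] using hw⟩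
    · refine Finset.mem_union_left _ ?_
      exact Finset.mem_filter.mpr ⟨Finset.mem_univ w, by simpa [joiningEnds, hwL, hw, h1] using hv⟩
  have h1 := Finset.card_le_card hsub
  have h2 := Finset.card_union_le (farFrom (hopNext G c) L) (B ∪ B.image (fun u => (c u).2))
  have h3 := Finset.card_union_le B (B.image (fun u => (c u).2))
  have h4 := Finset.card_image_le (s := B) (f := fun u => (c u).2)
  omega

lemma completeProb_le_farFrom (G₀ : SimpleGraph V) {n : ℕ} (hn : 1024 ≤ n) (L : Finset V)
    (hL0 : L.Nonempty) (hL4 : L.card ≤ 4) (hdeg : ∀ v ∉ L, n ≤ 16 * deg G₀ v) (t : ℕ) :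
    completeProb G₀ t ≤ Real.exp (-((1 - 1024 / n) ^ t * (farFrom G₀ L).card)) := by
  have hn' : (1024 : ℝ) ≤ n := by exact_mod_cast hn
  have hq : 8 * (128 / (n : ℝ)) = 1024 / n := by ring
  have := completeProb_le_of_potential G₀ (fun G => (farFrom G L).card)
    (fun G => joiningEnds G L)
    (q := 128 / n) (by positivity) (by rw [hq, div_le_one (by linarith)]; exact hn')
    ?_ (fun G _ c => card_farFrom_le_hopNext G L c) ?_ t
  · rwa [hq] at this
  · rw [Finset.card_eq_zero, Finset.eq_empty_iff_forall_notMem]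
    intro w hw
    simp only [farFrom, Finset.mem_filter, Finset.mem_univ, true_and, SimpleGraph.top_adj,
      not_not] at hw
    obtain ⟨v, hv⟩ := hL0
    exact hw.1 (hw.2 v hv ▸ hv)
  intro G hG
  have hfar : ∀ {w}, w ∈ farFrom G L → w ∉ L ∧ ∀ v ∈ L, ¬ G.Adj v w := fun h =>
    (Finset.mem_filter.mp h).2
  have hbound : ∀ u, endProb G u (joiningEnds G L u) ≤
      (if u ∈ L then ((farFrom G L).card : ℝ) * (16 / n) else 0) +
      (if u ∈ farFrom G L then (L.card : ℝ) * (16 / n) else 0) := by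
    intro u
    by_cases huL : u ∈ L
    · have huF : u ∉ farFrom G L := fun h => (hfar h).1 huL
      simp only [joiningEnds, huL, huF, if_true, if_false, add_zero]
      refine endProb_le G u _ huF (by positivity) fun v _ w hw hvw => ?_
      exact one_div_deg_le hG (by omega) (hdeg v fun hv => (hfar hw).2 v hv hvw)
    · by_cases huF : u ∈ farFrom G L
      · simp only [joiningEnds, huL, huF, if_true, if_false, zero_add]
        refine endProb_le G u _ huL (by positivity) fun v huv w _ _ => ?_
        exact one_div_deg_le hG (by omega) (hdeg v fun hv => (hfar huF).2 v hv huv.symm)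
      · simp [joiningEnds, huL, huF, endProb]
  refine (Finset.sum_le_sum fun u _ => hbound u).trans ?_
  rw [Finset.sum_add_distrib, ← Finset.sum_filter, ← Finset.sum_filter]
  simp only [Finset.filter_mem_eq_inter, Finset.univ_inter, Finset.sum_const, nsmul_eq_mul]
  have hL4' : (L.card : ℝ) ≤ 4 := by exact_mod_cast hL4
  have h1 : (L.card : ℝ) * (((farFrom G L).card : ℝ) * (16 / n)) ≤
      4 * (((farFrom G L).card : ℝ) * (16 / n)) := by gcongr
  have h2 : 128 / (n : ℝ) * ((farFrom G L).card : ℝ) =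
      8 * (((farFrom G L).card : ℝ) * (16 / n)) := by ring
  linarith

lemma completeProb_le_of_card_le (G : SimpleGraph V) {n : ℕ} (hV : Fintype.card V = n)
    (hn : 1024 ≤ n) (hM : (missingPairs G).card ≤ 4 * n) (t : ℕ) :
    completeProb G t ≤
      Real.exp (-((1 - 1024 / n) ^ t * (min ((missingPairs G).card : ℝ) n / 2))) := by
  have hn' : (1024 : ℝ) ≤ n := by exact_mod_cast hn
  have hθ : (0 : ℝ) ≤ (1 - 1024 / n) ^ t := by
    refine pow_nonneg ?_ t
    rw [sub_nonneg, div_le_one (by linarith)]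
    exact hn'
  set L : Finset V := Finset.univ.filter fun v => 16 * deg G v < n with hL
  have hdeg : ∀ v ∉ L, n ≤ 16 * deg G v := by
    intro v hv
    simpa [hL] using hv
  have hmin0 : (0 : ℝ) ≤ min ((missingPairs G).card : ℝ) n := le_min (by positivity) (by positivity)
  rcases L.eq_empty_or_nonempty with h0 | h0
  · refine (completeProb_le_of_minDeg G hn (fun v => hdeg v (by simp [h0])) t).trans ?_
    refine Real.exp_le_exp.mpr (neg_le_neg (mul_le_mul_of_nonneg_left ?_ hθ))
    linarith [min_le_left ((missingPairs G).card : ℝ) n]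
  have hlow : ∀ v ∈ L, 16 * deg G v < n := fun v hv => (Finset.mem_filter.mp hv).2
  have hsum : ∑ v ∈ L, (nonNbr G v).card ≤ 4 * n :=
    (Finset.sum_le_sum_of_subset (Finset.subset_univ L)).trans
      ((card_missingPairs G).symm.le.trans hM)
  have hL4 : L.card ≤ 4 := by
    by_contra hcon
    have h1 : ∑ v ∈ L, n ≤ ∑ v ∈ L, (nonNbr G v).card + ∑ v ∈ L, (n / 16 + 1) := by
      rw [← Finset.sum_add_distrib]
      refine Finset.sum_le_sum fun v hv => ?_
      have := card_nonNbr G v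
      have := hlow v hv
      omega
    simp only [Finset.sum_const, smul_eq_mul] at h1
    have h2 : 5 * (n - (n / 16 + 1)) ≤ L.card * (n - (n / 16 + 1)) :=
      Nat.mul_le_mul_right _ (by omega)
    rw [Nat.mul_sub L.card] at h2
    omega
  refine (completeProb_le_farFrom G hn L h0 hL4 hdeg t).trans ?_
  refine Real.exp_le_exp.mpr (neg_le_neg (mul_le_mul_of_nonneg_left ?_ hθ))
  have hcover : (Finset.univ : Finset V) ⊆ farFrom G L ∪ (L ∪ L.biUnion (nbr G)) := by
    intro w _
    by_cases hw : w ∈ farFrom G L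
    · exact Finset.mem_union_left _ hw
    refine Finset.mem_union_right _ ?_
    by_cases hwL : w ∈ L
    · exact Finset.mem_union_left _ hwL
    · refine Finset.mem_union_right _ ?_
      simp only [farFrom, Finset.mem_filter, Finset.mem_univ, true_and] at hw
      push Not at hw
      obtain ⟨v, hv, hvw⟩ := hw hwL
      exact Finset.mem_biUnion.mpr ⟨v, hv, mem_nbr.mpr hvw⟩
  have h1 := Finset.card_le_card hcover
  have h2 := Finset.card_union_le (farFrom G L) (L ∪ L.biUnion (nbr G))
  have h3 := Finset.card_union_le L (L.biUnion (nbr G))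
  have h4 : (L.biUnion (nbr G)).card ≤ L.card * (n / 16) :=
    Finset.card_biUnion_le_card_mul _ _ _ fun v hv => by
      have := hlow v hv
      change deg G v ≤ _
      omega
  have h5 : L.card * (n / 16) ≤ 4 * (n / 16) := Nat.mul_le_mul_right _ hL4
  rw [Finset.card_univ, hV] at h1
  have h6 : n ≤ 2 * (farFrom G L).card := by omega
  have h7 : (n : ℝ) ≤ 2 * (farFrom G L).card := by exact_mod_cast h6
  linarith [min_le_right ((missingPairs G).card : ℝ) n]

lemma completeProb_le_of_le_card {n : ℕ} (hV : Fintype.card V = n) (hn : 1024 ≤ n) (t : ℕ)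
    (G : SimpleGraph V) (hM : 2 * n ≤ (missingPairs G).card) :
    completeProb G t ≤ Real.exp (-((1 - 1024 / n) ^ t * (n / 2))) := by
  have hn' : (1024 : ℝ) ≤ n := by exact_mod_cast hn
  have hG : G ≠ ⊤ := by
    rintro rfl
    rw [missingPairs_top, Finset.card_empty] at hM
    omega
  have hr1 : 1024 / (n : ℝ) ≤ 1 := by
    rw [div_le_one (by linarith)]
    exact hn'
  have hr0 : 0 ≤ 1024 / (n : ℝ) := by positivity
  induction t generalizing G with
  | zero =>
    rw [completeProb, hitProb_zero hG]
    exact (Real.exp_pos _).le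
  | succ t ih =>
    by_cases hM4 : (missingPairs G).card ≤ 4 * n
    · have h := completeProb_le_of_card_le G hV hn hM4 (t + 1)
      have hmin : min ((missingPairs G).card : ℝ) n = n := by
        refine min_eq_right ?_
        exact_mod_cast (by omega : n ≤ (missingPairs G).card)
      rwa [hmin] at h
    rw [completeProb_succ hG]
    calc ∑ c, hopWeight G c * completeProb (hopNext G c) t
        ≤ ∑ c, hopWeight G c * Real.exp (-((1 - 1024 / n) ^ t * (n / 2))) := by
          refine Finset.sum_le_sum fun c _ => mul_le_mul_of_nonneg_left ?_ (hopWeight_nonneg G c)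
          have h1 := card_missingPairs_le_hopNext G c
          have h2 := Finset.card_le_univ (Finset.univ.filter fun u => (c u).2 ∈ nonNbr G u)
          rw [hV] at h2
          have h3 : 2 * n ≤ (missingPairs (hopNext G c)).card := by omega
          refine ih _ h3 ?_
          intro h
          rw [h, missingPairs_top, Finset.card_empty] at h3
          omega
      _ = Real.exp (-((1 - 1024 / n) ^ t * (n / 2))) := by
          rw [← Finset.sum_mul, sum_hopWeight, one_mul]
      _ ≤ Real.exp (-((1 - 1024 / n) ^ (t + 1) * (n / 2))) := by
          refine Real.exp_le_exp.mpr (neg_le_neg (mul_le_mul_of_nonneg_right ?_ (by positivity)))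
          exact pow_le_pow_of_le_one (by linarith) (by linarith) (Nat.le_succ t)

lemma completeProb_le_min (G : SimpleGraph V) {n : ℕ} (hV : Fintype.card V = n)
    (hn : 1024 ≤ n) (t : ℕ) :
    completeProb G t ≤
      Real.exp (-((1 - 1024 / n) ^ t * (min ((missingPairs G).card : ℝ) n / 2))) := by
  by_cases hM : (missingPairs G).card ≤ 4 * n
  · exact completeProb_le_of_card_le G hV hn hM t
  · have hmin : min ((missingPairs G).card : ℝ) n = n := by
      refine min_eq_right ?_
      exact_mod_cast (by omega : n ≤ (missingPairs G).card)
    rw [hmin]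
    exact completeProb_le_of_le_card hV hn t G (by omega)

end Round

lemma exp_neg_two_mul_le_one_sub {r : ℝ} (h0 : 0 ≤ r) (h1 : r ≤ 1 / 2) :
    Real.exp (-(2 * r)) ≤ 1 - r := by
  rw [Real.exp_neg, inv_le_comm₀ (Real.exp_pos _) (by linarith)]
  refine le_trans ?_ (Real.add_one_le_exp (2 * r))
  rw [inv_le_iff_one_le_mul₀ (by linarith)]
  nlinarith

lemma rpow_le_one_sub_pow {n k T : ℕ} (hn : 2048 ≤ n) (hk : 1 ≤ k)
    (hT : (T : ℝ) ≤ 1 / 16384 * n * Real.log k) :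
    (k : ℝ) ^ (-(1 / 8) : ℝ) ≤ (1 - 1024 / (n : ℝ)) ^ T := by
  have hn' : (2048 : ℝ) ≤ n := by exact_mod_cast hn
  have hk' : (0 : ℝ) < k := by exact_mod_cast hk
  have h := exp_neg_two_mul_le_one_sub (r := 1024 / (n : ℝ)) (by positivity)
    (by rw [div_le_div_iff₀ (by linarith) (by norm_num)]; linarith)
  refine le_trans ?_ (pow_le_pow_left₀ (Real.exp_pos _).le h T)
  rw [← Real.exp_nat_mul, Real.rpow_def_of_pos hk']
  refine Real.exp_le_exp.mpr ?_
  have h2 : (T : ℝ) * (2 * (1024 / n)) ≤ 1 / 16384 * n * Real.log k * (2 * (1024 / n)) := by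
    gcongr
  have h3 : 1 / 16384 * n * Real.log k * (2 * (1024 / n)) = Real.log k * (1 / 8) := by
    field_simp
    ring
  linarith

lemma rpow_quarter_le {k : ℕ} :
    (k : ℝ) ^ (1 / 4 : ℝ) ≤ (k : ℝ) ^ (3 / 8 : ℝ) / 2 + 1 := by
  set y : ℝ := (k : ℝ) ^ (1 / 8 : ℝ) with hy
  have hy0 : 0 ≤ y := by positivity
  have h2 : (k : ℝ) ^ (1 / 4 : ℝ) = y ^ 2 := by
    rw [hy, ← Real.rpow_mul_natCast (by positivity)]
    norm_num
  have h3 : (k : ℝ) ^ (3 / 8 : ℝ) = y ^ 3 := by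
    rw [hy, ← Real.rpow_mul_natCast (by positivity)]
    norm_num
  rw [h2, h3]
  nlinarith [mul_nonneg hy0 (sq_nonneg (y - 3 / 2)), sq_nonneg (y - 4 / 3), sq_nonneg (y - 1)]

end TwoHop

/-- There are constants `c > 0` and `c' > 0` such that the following
holds.  Let `G₀` be a connected simple graph on `n ≥ 2` vertices whose edge set has
`k ≥ 2` fewer edges than the complete graph on the same vertex set.  Then the
probability that the two-hop walk process started at `G₀` reaches the complete graph
within `⌊c·n·ln k⌋` rounds is at most `c'·exp(−k^(1/4))`. -/
theorem twoHop_lower_bound :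
    ∃ c : ℝ, 0 < c ∧ ∃ c' : ℝ, 0 < c' ∧
      ∀ (V : Type) [Fintype V] [DecidableEq V] (n : ℕ), 2 ≤ n → Fintype.card V = n →
        ∀ (G0 : SimpleGraph V), G0.Connected →
          ∀ k : ℕ, 2 ≤ k →
            (Finset.univ.filter (fun e : Sym2 V => e ∈ G0.edgeSet)).card + k =
              Nat.choose n 2 →
          ∀ T : ℕ, T = ⌊c * n * Real.log k⌋₊ →
            trajProb hopStep G0 T (fun g => ∃ t ≤ T, g t = (⊤ : SimpleGraph V)) ≤
              c' * Real.exp (-(k : ℝ) ^ ((1 : ℝ) / 4)) := by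
  refine ⟨1 / 16384, by norm_num, Real.exp (2048 ^ 2 + 1), Real.exp_pos _, ?_⟩
  intro V _ _ n _ hV G0 _ k hk hcard T hT
  rw [TwoHop.trajProb_eq_hitProb, ← Real.exp_add]
  subst hV
  have hM := TwoHop.card_missingPairs_eq G0 hcard
  have hk1 : (1 : ℝ) ≤ k := by exact_mod_cast (by omega : 1 ≤ k)
  have hkn : (k : ℝ) ≤ (Fintype.card V : ℝ) ^ 2 := by
    have h1 : k ≤ Fintype.card V ^ 2 := by
      have := Nat.choose_le_pow (Fintype.card V) 2
      omega
    exact_mod_cast h1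
  by_cases hn : 2048 ≤ Fintype.card V
  · refine (TwoHop.completeProb_le_min G0 rfl (by omega) T).trans (Real.exp_le_exp.mpr ?_)
    have hT' : (T : ℝ) ≤ 1 / 16384 * Fintype.card V * Real.log k := by
      rw [hT]
      exact Nat.floor_le (mul_nonneg (by positivity) (Real.log_nonneg hk1))
    have hpow := TwoHop.rpow_le_one_sub_pow hn (by omega) hT'
    have hmin : (k : ℝ) ^ (1 / 2 : ℝ) ≤
        min ((TwoHop.missingPairs G0).card : ℝ) (Fintype.card V) := by
      rw [← Real.sqrt_eq_rpow]
      refine le_min ?_ (Real.sqrt_le_left (by positivity) |>.mpr hkn)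
      rw [hM, Real.sqrt_le_left (by positivity)]
      push_cast
      nlinarith
    have hprod : (k : ℝ) ^ (3 / 8 : ℝ) / 2 ≤ (1 - 1024 / (Fintype.card V : ℝ)) ^ T *
        (min ((TwoHop.missingPairs G0).card : ℝ) (Fintype.card V) / 2) := by
      have h1 : (k : ℝ) ^ (3 / 8 : ℝ) = (k : ℝ) ^ (-(1 / 8) : ℝ) * (k : ℝ) ^ (1 / 2 : ℝ) := by
        rw [← Real.rpow_add (by linarith)]
        norm_num
      rw [h1, mul_div_assoc]
      have h0 : (0 : ℝ) ≤ (k : ℝ) ^ (-(1 / 8) : ℝ) := by positivity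
      exact mul_le_mul hpow (by linarith) (by positivity) (h0.trans hpow)
    have := TwoHop.rpow_quarter_le (k := k)
    nlinarith
  · refine (TwoHop.completeProb_le_one G0 T).trans (Real.one_le_exp ?_)
    have h1 : (k : ℝ) ^ (1 / 4 : ℝ) ≤ k := by
      simpa using Real.rpow_le_rpow_of_exponent_le hk1 (by norm_num : (1 / 4 : ℝ) ≤ 1)
    have h2 : (Fintype.card V : ℝ) ≤ 2048 := by exact_mod_cast (not_le.mp hn).le
    have h3 : (Fintype.card V : ℝ) ^ 2 ≤ 2048 ^ 2 := by gcongr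
    linarith
end

section
/- There exist a constant c > 0 and an integer n₀ such that for every even n ≥ n₀ there exists a strongly connected simple directed graph G₀ on n vertices for which the expected number of rounds until the directed two-hop process started at G₀ terminates is at least c·n². -/
open scoped Classical

noncomputable section

variable {V : Type} [Fintype V] [DecidableEq V]

/-- The out-neighbors of `u` in the directed graph `f`. -/
def outN (f : V → V → Bool) (u : V) : Finset V := Finset.univ.filter (fun v => f u v = true)

/-- The out-degree of `u` in the directed graph `f`. -/
def outDeg (f : V → V → Bool) (u : V) : ℕ := (outN f u).card

/-- The directed graph obtained from a choice function `c` in one round of the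
directed two-hop process: every vertex `u` adds the directed edge to the endpoint
`(c u).2` of its two-hop walk, provided it is not a self-loop; all additions are
simultaneous. -/
def dirNext (f : V → V → Bool) (c : V → V × V) : V → V → Bool :=
  fun a b => f a b || (decide (a ≠ b) && decide ((c a).2 = b))

/-- The probability that in one round of the directed two-hop process on the current
directed graph `f` the vertices make exactly the choices recorded by `c`: each vertex
`u` with at least one out-neighbor independently picks a uniformly random out-neighbor
`v = (c u).1` and, if `v` has at least one out-neighbor, a uniformly random
out-neighbor `w = (c u).2` of `v`.  Vertices with no out-neighbor get the dummy choice
`(u, u)`, and a dead-end first hop `v` gets the dummy second coordinate `u` (in both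
dummy cases no edge is added, as the would-be edge is a self-loop). -/
def dirWeight (f : V → V → Bool) (c : V → V × V) : ℝ :=
  ∏ u : V,
    if outDeg f u = 0 then (if c u = (u, u) then 1 else 0)
    else if (c u).1 ∈ outN f u then
      (if outDeg f (c u).1 = 0 then
        (if (c u).2 = u then (1 : ℝ) / (outDeg f u : ℝ) else 0)
       else if (c u).2 ∈ outN f (c u).1 then
        (1 : ℝ) / ((outDeg f u : ℝ) * (outDeg f (c u).1 : ℝ)) else 0)
    else 0

/-- Transition probability of one round of the directed two-hop process. -/
def dirStep (f g : V → V → Bool) : ℝ :=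
  ∑ c : V → V × V, if dirNext f c = g then dirWeight f c else 0

/-- `reaches f u v` means that the directed graph `f` contains a directed path from
`u` to `v`. -/
def reaches (f : V → V → Bool) (u v : V) : Prop :=
  Relation.ReflTransGen (fun a b => f a b = true) u v

/-- The directed two-hop process started at `f0` has terminated in the state `f` if,
for every ordered pair of distinct vertices `(u, v)` such that `f0` contains a directed
path from `u` to `v`, the directed edge `(u, v)` belongs to `f`. -/
def terminated (f0 f : V → V → Bool) : Prop :=
  ∀ u v : V, u ≠ v → reaches f0 u v → f u v = true

/-- `distAt step g0 t` is the distribution (probability mass function) of the state at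
time `t` of the Markov chain with one-step transition probabilities `step` started at
`g0`. -/
def distAt {Γ : Type} [Fintype Γ] (step : Γ → Γ → ℝ) (g0 : Γ) : ℕ → Γ → ℝ
  | 0 => fun g => if g = g0 then 1 else 0
  | (t + 1) => fun g => ∑ h : Γ, distAt step g0 t h * step h g

end

/-- The total weight `∑ y ^ (length of p)` of all increasing paths `p` from `b` to `e` along `H`. -/
noncomputable def pathWeight {n : ℕ} (H : Fin n → Fin n → Prop) (y : ℝ) (e b : Fin n) : ℝ :=
  if b = e then 1
  else y * ∑ c : Fin n, if _h : b < c then (if H b c then pathWeight H y e c else 0) else 0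
termination_by n - b.val
decreasing_by omega

/-- Forward edges after one round with choices `x` at `u`, when `S` is the set of
vertices already known from behind. -/
def forwardNext {n : ℕ} (S : Fin n → Prop) (H : Fin n → Fin n → Prop) (u : Fin n)
    (x : Fin n × Fin n) (v : Fin n) : Prop :=
  H u v ∨ (¬ S x.1 ∧ H u x.1 ∧ H x.1 x.2 ∧ x.2 = v)

/-- The set of vertices known from behind after one round with choices `c`. -/
def knownNext {n : ℕ} (S : Fin n → Prop) (H : Fin n → Fin n → Prop)
    (c : Fin n → Fin n × Fin n) (v : Fin n) : Prop :=
  S v ∨ ∃ a, S (c a).1 ∧ H (c a).1 v ∧ (c a).2 = v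

/-- The factor of `dirWeight` contributed by the vertex `u` choosing `x`. -/
noncomputable def rowWeight {V : Type} [Fintype V] [DecidableEq V] (f : V → V → Bool) (u : V)
    (x : V × V) : ℝ :=
  if outDeg f u = 0 then (if x = (u, u) then 1 else 0)
  else if x.1 ∈ outN f u then
    (if outDeg f x.1 = 0 then
      (if x.2 = u then (1 : ℝ) / (outDeg f u : ℝ) else 0)
     else if x.2 ∈ outN f x.1 then
      (1 : ℝ) / ((outDeg f u : ℝ) * (outDeg f x.1 : ℝ)) else 0)
  else 0

/-- The transition operator of a finite Markov chain acting on functions. -/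
noncomputable def stepOp {Γ : Type} [Fintype Γ] (step : Γ → Γ → ℝ) (φ : Γ → ℝ) (g : Γ) : ℝ :=
  ∑ h, step g h * φ h

theorem pathWeight_self {n : ℕ} (H : Fin n → Fin n → Prop) (y : ℝ) (e : Fin n) :
    pathWeight H y e e = 1 := by
  rw [pathWeight]; simp

theorem pathWeight_of_ne {n : ℕ} {H : Fin n → Fin n → Prop} (hH : ∀ u v, H u v → u < v) (y : ℝ)
    {e b : Fin n} (hb : b ≠ e) :
    pathWeight H y e b = y * ∑ c : Fin n, (if H b c then 1 else 0) * pathWeight H y e c := by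
  rw [pathWeight, if_neg hb]
  congr 1
  refine Finset.sum_congr rfl fun c _ => ?_
  by_cases h : H b c
  · simp [h, hH _ _ h]
  · simp [h]

theorem pathWeight_nonneg {n : ℕ} {H : Fin n → Fin n → Prop} (hH : ∀ u v, H u v → u < v) {y : ℝ}
    (hy : 0 ≤ y) (e b : Fin n) : 0 ≤ pathWeight H y e b := by
  induction b using WellFoundedGT.induction with
  | ind b ih =>
    by_cases hb : b = e
    · subst hb; rw [pathWeight_self]; exact zero_le_one
    · rw [pathWeight_of_ne hH y hb]
      refine mul_nonneg hy (Finset.sum_nonneg fun c _ => ?_)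
      split_ifs with h
      · rw [one_mul]; exact ih c (hH _ _ h)
      · simp

theorem pathWeight_congr {n : ℕ} {H H' : Fin n → Fin n → Prop} (hH : ∀ u v, H u v → u < v)
    (hH' : ∀ u v, H' u v → u < v) (y : ℝ) (e b : Fin n)
    (h : ∀ u, b ≤ u → ∀ v, H u v ↔ H' u v) : pathWeight H y e b = pathWeight H' y e b := by
  induction b using WellFoundedGT.induction with
  | ind b ih =>
    by_cases hb : b = e
    · subst hb; rw [pathWeight_self, pathWeight_self]
    · rw [pathWeight_of_ne hH y hb, pathWeight_of_ne hH' y hb]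
      congr 1
      refine Finset.sum_congr rfl fun c _ => ?_
      have h1 := h b le_rfl c
      by_cases hc : H b c
      · rw [ih c (hH _ _ hc) fun u hu => h u ((hH _ _ hc).le.trans hu)]
        simp [hc, h1.1 hc]
      · rw [if_neg hc, if_neg fun h' => hc (h1.2 h'), zero_mul, zero_mul]

theorem sum_pathWeight_le {n : ℕ} {H : Fin n → Fin n → Prop} (hH : ∀ u v, H u v → u < v) {y : ℝ}
    (hy : 0 < y) {e : Fin n} (he : ∀ v, v ≤ e) (b : Fin n) :
    ∑ c : Fin n, (if H b c then 1 else 0) * pathWeight H y e c ≤ pathWeight H y e b / y := by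
  by_cases hb : b = e
  · subst hb
    rw [pathWeight_self, Finset.sum_eq_zero]
    · positivity
    · intro c _
      rw [if_neg fun h => (hH _ _ h).not_ge (he c), zero_mul]
  · rw [pathWeight_of_ne hH y hb, mul_div_cancel_left₀ _ hy.ne']

theorem sum_prod_mul_indep {V X : Type} [Fintype V] [DecidableEq V] [Fintype X]
    {w : V → X → ℝ} (hw : ∀ u, ∑ x, w u x = 1) (b : V) (f : X → ℝ) (g : (V → X) → ℝ)
    (hg : ∀ c x, g (Function.update c b x) = g c) :
    ∑ c : V → X, (∏ u, w u (c u)) * (f (c b) * g c) =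
      (∑ x, w b x * f x) * ∑ c : V → X, (∏ u, w u (c u)) * g c := by
  have key : ∀ f : X → ℝ, ∑ c : V → X, (∏ u, w u (c u)) * (f (c b) * g c) =
      (∑ x, w b x * f x) * ∑ c : {j // j ≠ b} → X,
        (∏ u : {j // j ≠ b}, w u (c u)) * ∑ x, w b x * g ((Equiv.funSplitAt b X).symm (x, c)) := by
    intro f
    rw [← (Equiv.funSplitAt b X).symm.sum_comp, Fintype.sum_prod_type, Finset.sum_mul]
    refine Finset.sum_congr rfl fun x _ => ?_
    rw [Finset.mul_sum]
    refine Finset.sum_congr rfl fun c _ => ?_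
    have h1 : ∀ x', g ((Equiv.funSplitAt b X).symm (x', c)) =
        g ((Equiv.funSplitAt b X).symm (x, c)) := by
      intro x'
      rw [← hg ((Equiv.funSplitAt b X).symm (x, c)) x']
      congr 1
      ext j
      by_cases hj : j = b
      · subst hj; simp [Equiv.funSplitAt, Equiv.piSplitAt]
      · simp [Equiv.funSplitAt, Equiv.piSplitAt, hj]
    simp only [h1]
    rw [← Finset.sum_mul, hw, Fintype.prod_eq_mul_prod_subtype_ne _ b]
    have h2 : ∀ j : {j // j ≠ b}, (Equiv.funSplitAt b X).symm (x, c) j = c j := by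
      intro j; simp [Equiv.funSplitAt, Equiv.piSplitAt, j.2]
    have h3 : (Equiv.funSplitAt b X).symm (x, c) b = x := by
      simp [Equiv.funSplitAt, Equiv.piSplitAt]
    simp only [h2, h3]
    ring
  have h1 := key fun _ => 1
  simp only [one_mul, mul_one, hw] at h1
  rw [key f, h1]

theorem sum_prod_mul_pathWeight_le {n : ℕ} {X : Type} [Fintype X] {w : Fin n → X → ℝ}
    (hw0 : ∀ u x, 0 ≤ w u x) (hw : ∀ u, ∑ x, w u x = 1)
    {H : Fin n → Fin n → Prop} (hH : ∀ u v, H u v → u < v)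
    {A : Fin n → X → Fin n → Prop} (hA : ∀ u x v, A u x v → u < v)
    {y δ : ℝ} (hy : 0 < y) (hδ : 0 ≤ δ) {e : Fin n} (he : ∀ v, v ≤ e)
    (hAH : ∀ u v, ∑ x, w u x * (if A u x v then 1 else 0) ≤
      (if H u v then 1 else 0) +
        δ * ∑ z, (if H u z then (1 : ℝ) else 0) * (if H z v then 1 else 0)) (b : Fin n) :
    ∑ c : Fin n → X, (∏ u, w u (c u)) * pathWeight (fun u v => A u (c u) v) y e b ≤
      pathWeight H (y + δ) e b := by
  have hz : 0 < y + δ := by positivity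
  have hA' : ∀ c : Fin n → X, ∀ u v, A u (c u) v → u < v := fun c u v => hA u _ v
  have hnn : ∀ v, 0 ≤ ∑ c : Fin n → X,
      (∏ u, w u (c u)) * pathWeight (fun u v => A u (c u) v) y e v := fun v =>
    Finset.sum_nonneg fun c _ => mul_nonneg (Finset.prod_nonneg fun u _ => hw0 _ _)
      (pathWeight_nonneg (hA' c) hy.le _ _)
  induction b using WellFoundedGT.induction with
  | ind b ih =>
    by_cases hb : b = e
    · subst hb
      simp only [pathWeight_self, mul_one]
      rw [← Fintype.prod_sum]
      simp [hw]
    · have hP := pathWeight_nonneg hH hz.le e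
      have h1 : ∑ c : Fin n → X, (∏ u, w u (c u)) * pathWeight (fun u v => A u (c u) v) y e b =
          y * ∑ v, (∑ x, w b x * (if A b x v then 1 else 0)) *
            ∑ c : Fin n → X, (∏ u, w u (c u)) * pathWeight (fun u v => A u (c u) v) y e v := by
        have : ∀ c : Fin n → X, (∏ u, w u (c u)) * pathWeight (fun u v => A u (c u) v) y e b =
            ∑ v, y * ((∏ u, w u (c u)) * ((if A b (c b) v then 1 else 0) *
              if b < v then pathWeight (fun u v => A u (c u) v) y e v else 0)) := by
          intro c
          rw [pathWeight_of_ne (hA' c) y hb, Finset.mul_sum, Finset.mul_sum]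
          refine Finset.sum_congr rfl fun v _ => ?_
          by_cases h : A b (c b) v
          · simp only [h, hA _ _ _ h, if_true]; ring
          · simp [h]
        rw [Finset.sum_congr rfl fun c _ => this c, Finset.sum_comm, Finset.mul_sum]
        refine Finset.sum_congr rfl fun v _ => ?_
        rw [← Finset.mul_sum]
        congr 1
        by_cases hbv : b < v
        · simp only [hbv, if_true]
          rw [sum_prod_mul_indep hw b (fun x => if A b x v then 1 else 0)]
          intro c x
          refine pathWeight_congr (hA' _) (hA' _) _ _ _ fun u hu v' => ?_
          rw [Function.update_of_ne (hbv.trans_le hu).ne']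
        · have : ∀ x, ¬ A b x v := fun x h => hbv (hA _ _ _ h)
          simp [hbv, this]
      have h2 : ∀ v, (∑ x, w b x * (if A b x v then 1 else 0)) *
            ∑ c : Fin n → X, (∏ u, w u (c u)) * pathWeight (fun u v => A u (c u) v) y e v ≤
          ((if H b v then 1 else 0) +
            δ * ∑ z, (if H b z then (1 : ℝ) else 0) * (if H z v then 1 else 0)) *
              pathWeight H (y + δ) e v := by
        intro v
        by_cases hbv : b < v
        · refine mul_le_mul (hAH b v) (ih v hbv) (hnn v) ?_
          refine (Finset.sum_nonneg fun x _ => mul_nonneg (hw0 _ _) ?_).trans (hAH b v)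
          split_ifs <;> simp
        · have : ∀ x, ¬ A b x v := fun x h => hbv (hA _ _ _ h)
          simp only [this, if_false, mul_zero, Finset.sum_const_zero, zero_mul]
          refine mul_nonneg (add_nonneg ?_ (mul_nonneg hδ (Finset.sum_nonneg fun z _ =>
            mul_nonneg ?_ ?_))) (hP v) <;> split_ifs <;> simp
      have h3 : ∑ v, ((if H b v then 1 else 0) +
            δ * ∑ z, (if H b z then (1 : ℝ) else 0) * (if H z v then 1 else 0)) *
              pathWeight H (y + δ) e v =
          ∑ v, (if H b v then 1 else 0) * pathWeight H (y + δ) e v +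
            δ * ∑ z, (if H b z then (1 : ℝ) else 0) *
              ∑ v, (if H z v then 1 else 0) * pathWeight H (y + δ) e v := by
        simp only [add_mul, Finset.sum_add_distrib, Finset.mul_sum, Finset.sum_mul]
        congr 1
        rw [Finset.sum_comm]
        refine Finset.sum_congr rfl fun z _ => Finset.sum_congr rfl fun v _ => ?_
        ring
      have h4 : ∑ z, (if H b z then (1 : ℝ) else 0) *
              ∑ v, (if H z v then 1 else 0) * pathWeight H (y + δ) e v ≤
          pathWeight H (y + δ) e b / (y + δ) / (y + δ) := by
        refine le_trans ?_ (div_le_div_of_nonneg_right (sum_pathWeight_le hH hz he b) hz.le)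
        rw [Finset.sum_div]
        refine Finset.sum_le_sum fun z _ => ?_
        rw [mul_div_assoc]
        refine mul_le_mul_of_nonneg_left (sum_pathWeight_le hH hz he z) ?_
        split_ifs <;> simp
      rw [h1]
      calc _ ≤ y * (pathWeight H (y + δ) e b / (y + δ) +
              δ * (pathWeight H (y + δ) e b / (y + δ) / (y + δ))) := by
            refine mul_le_mul_of_nonneg_left ?_ hy.le
            refine (Finset.sum_le_sum fun v _ => h2 v).trans ?_
            rw [h3]
            exact add_le_add (sum_pathWeight_le hH hz he b) (mul_le_mul_of_nonneg_left h4 hδ)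
        _ = pathWeight H (y + δ) e b * (y * (y + 2 * δ) / (y + δ) ^ 2) := by
            field_simp; ring
        _ ≤ pathWeight H (y + δ) e b := by
            refine mul_le_of_le_one_right (hP b) ?_
            rw [div_le_one (by positivity)]
            nlinarith [sq_nonneg δ]

theorem forwardNext_lt {n : ℕ} {S : Fin n → Prop} {H : Fin n → Fin n → Prop}
    (hH : ∀ u v, H u v → u < v) (u : Fin n) (x : Fin n × Fin n) (v : Fin n)
    (h : forwardNext S H u x v) : u < v := by
  rcases h with h | ⟨_, h1, h2, rfl⟩
  · exact hH _ _ h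
  · exact (hH _ _ h1).trans (hH _ _ h2)

theorem sum_mul_forwardNext_le {n : ℕ} {S : Fin n → Prop} {H : Fin n → Fin n → Prop}
    {p : Fin n × Fin n → ℝ} (hp0 : ∀ x, 0 ≤ p x) (hp : ∑ x, p x = 1) {δ : ℝ}
    (hpδ : ∀ x, p x ≤ δ) (u v : Fin n) :
    ∑ x, p x * (if forwardNext S H u x v then 1 else 0) ≤
      (if H u v then 1 else 0) +
        δ * ∑ z, (if H u z then (1 : ℝ) else 0) * (if H z v then 1 else 0) := by
  have h0 : ∀ z, 0 ≤ (if H u z then (1 : ℝ) else 0) * (if H z v then 1 else 0) := by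
    intro z; split_ifs <;> simp
  have h1 : ∀ x, p x * (if forwardNext S H u x v then 1 else 0) ≤
      p x * (if H u v then 1 else 0) +
        if x.2 = v then p x * ((if H u x.1 then (1 : ℝ) else 0) * (if H x.1 v then 1 else 0))
        else 0 := by
    intro x
    have := hp0 x
    by_cases hx : forwardNext S H u x v
    · rcases hx with h | ⟨hS, h1, h2, rfl⟩
      · have : forwardNext S H u x v := Or.inl h
        simp only [this, h, if_true]
        have := h0 x.1
        split_ifs <;> simp <;> positivity
      · have : forwardNext S H u x x.2 := Or.inr ⟨hS, h1, h2, rfl⟩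
        simp only [this, h1, h2, if_true]
        split_ifs <;> simp <;> positivity
    · simp only [hx, if_false, mul_zero]
      have := h0 x.1
      split_ifs <;> simp <;> positivity
  refine (Finset.sum_le_sum fun x _ => h1 x).trans ?_
  rw [Finset.sum_add_distrib, ← Finset.sum_mul, hp, one_mul, Fintype.sum_prod_type, Finset.mul_sum]
  refine add_le_add le_rfl (Finset.sum_le_sum fun z _ => ?_)
  rw [Finset.sum_ite_eq' Finset.univ v, if_pos (Finset.mem_univ v)]
  exact mul_le_mul_of_nonneg_right (hpδ _) (h0 z)

theorem sum_prod_mul_known_le {n : ℕ} {w : Fin n → Fin n × Fin n → ℝ}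
    (hw0 : ∀ u x, 0 ≤ w u x) (hw : ∀ u, ∑ x, w u x = 1) {δ : ℝ} (hδ : 0 ≤ δ)
    (hwδ : ∀ u x, w u x ≤ δ) {S : Fin n → Prop}
    {H : Fin n → Fin n → Prop} (hH : ∀ u v, H u v → u < v)
    {y : ℝ} (hy : 0 < y) {e : Fin n} (he : ∀ v, v ≤ e) :
    ∑ c : Fin n → Fin n × Fin n, (∏ u, w u (c u)) *
      (∑ v, (if knownNext S H c v then 1 else 0) *
        pathWeight (fun u v => forwardNext S H u (c u) v) y e v) ≤
      (1 + n * δ / y) * ∑ v, (if S v then 1 else 0) * pathWeight H (y + δ) e v := by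
  have hz : 0 < y + δ := by positivity
  have hN := fun c : Fin n → Fin n × Fin n =>
    pathWeight_nonneg (fun u v => forwardNext_lt (S := S) hH u (c u) v) hy.le e
  have hprod : ∀ c : Fin n → Fin n × Fin n, 0 ≤ ∏ u, w u (c u) := fun c =>
    Finset.prod_nonneg fun u _ => hw0 _ _
  have hP := pathWeight_nonneg hH hz.le e
  have hexp : ∀ v, ∑ c : Fin n → Fin n × Fin n, (∏ u, w u (c u)) *
      pathWeight (fun u v => forwardNext S H u (c u) v) y e v ≤ pathWeight H (y + δ) e v :=
    sum_prod_mul_pathWeight_le hw0 hw hH (forwardNext_lt hH) hy hδ he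
      fun u v => sum_mul_forwardNext_le (hw0 u) (hw u) (hwδ u) u v
  have hcond : ∀ a b v, S b → ∑ c : Fin n → Fin n × Fin n, (∏ u, w u (c u)) *
      ((if c a = (b, v) then 1 else 0) *
        pathWeight (fun u v => forwardNext S H u (c u) v) y e v) ≤
      δ * pathWeight H (y + δ) e v := by
    intro a b v hb
    set w' : Fin n → Fin n × Fin n → ℝ :=
      Function.update w a (fun x => if x = (b, v) then 1 else 0) with hw'
    have hw'0 : ∀ u x, 0 ≤ w' u x := by
      intro u x
      by_cases hu : u = a
      · subst hu; simp only [hw', Function.update_self]; split_ifs <;> simp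
      · simp only [hw', Function.update_of_ne hu]; exact hw0 _ _
    have hw'1 : ∀ u, ∑ x, w' u x = 1 := by
      intro u
      by_cases hu : u = a
      · subst hu; simp [hw', Function.update_self]
      · simp only [hw', Function.update_of_ne hu]; exact hw _
    have hle : ∑ c : Fin n → Fin n × Fin n, (∏ u, w' u (c u)) *
        pathWeight (fun u v => forwardNext S H u (c u) v) y e v ≤ pathWeight H (y + δ) e v := by
      refine sum_prod_mul_pathWeight_le hw'0 hw'1 hH (forwardNext_lt hH) hy hδ he
        (fun u v' => ?_) v
      by_cases hu : u = a
      · subst hu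
        simp only [hw', Function.update_self]
        have : forwardNext S H u (b, v) v' ↔ H u v' := by simp [forwardNext, hb]
        simp only [ite_mul, one_mul, zero_mul]
        rw [Finset.sum_ite_eq' Finset.univ (b, v), if_pos (Finset.mem_univ _)]
        simp only [this]
        refine le_add_of_nonneg_right (mul_nonneg hδ (Finset.sum_nonneg fun z _ => ?_))
        split_ifs <;> simp
      · simp only [hw', Function.update_of_ne hu]
        exact sum_mul_forwardNext_le (hw0 u) (hw u) (hwδ u) u v'
    have heq : ∀ c : Fin n → Fin n × Fin n,
        (∏ u, w u (c u)) * (if c a = (b, v) then 1 else 0) =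
          w a (b, v) * ∏ u, w' u (c u) := by
      intro c
      rw [Fintype.prod_eq_mul_prod_subtype_ne _ a,
        Fintype.prod_eq_mul_prod_subtype_ne (fun u => w' u (c u)) a]
      have : ∀ u : {u // u ≠ a}, w' u (c u) = w u (c u) := fun u => by
        simp only [hw', Function.update_of_ne u.2]
      have hself : w' a (c a) = if c a = (b, v) then 1 else 0 := by
        simp only [hw', Function.update_self]
      rw [Finset.prod_congr rfl fun u _ => this u, hself]
      by_cases h : c a = (b, v)
      · simp [h]
      · simp [h]
    calc _ = w a (b, v) * ∑ c : Fin n → Fin n × Fin n, (∏ u, w' u (c u)) *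
        pathWeight (fun u v => forwardNext S H u (c u) v) y e v := by
          rw [Finset.mul_sum]
          refine Finset.sum_congr rfl fun c _ => ?_
          rw [← mul_assoc, heq, mul_assoc]
      _ ≤ w a (b, v) * pathWeight H (y + δ) e v := mul_le_mul_of_nonneg_left hle (hw0 _ _)
      _ ≤ _ := mul_le_mul_of_nonneg_right (hwδ _ _) (hP v)
  have hpt : ∀ (c : Fin n → Fin n × Fin n) (v : Fin n),
      (if knownNext S H c v then (1 : ℝ) else 0) ≤ (if S v then 1 else 0) +
        ∑ a, ∑ b, (if S b then 1 else 0) * (if H b v then 1 else 0) *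
          (if c a = (b, v) then 1 else 0) := by
    intro c v
    have h0 : ∀ a b, (0 : ℝ) ≤ (if S b then 1 else 0) * (if H b v then 1 else 0) *
          (if c a = (b, v) then 1 else 0) := by
      intro a b; split_ifs <;> simp
    have h00 : (0 : ℝ) ≤ if S v then 1 else 0 := by split_ifs <;> simp
    have hs := Finset.sum_nonneg fun a (_ : a ∈ Finset.univ) =>
      Finset.sum_nonneg fun b (_ : b ∈ Finset.univ) => h0 a b
    by_cases hk : knownNext S H c v
    · rw [if_pos hk]
      rcases hk with h | ⟨a, h1, h2, h3⟩
      · rw [if_pos h]; linarith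
      · have e1 := Finset.single_le_sum (fun a (_ : a ∈ Finset.univ) =>
          Finset.sum_nonneg fun b (_ : b ∈ Finset.univ) => h0 a b) (Finset.mem_univ a)
        have e2 := Finset.single_le_sum (fun b (_ : b ∈ Finset.univ) => h0 a b)
          (Finset.mem_univ (c a).1)
        have e3 : c a = ((c a).1, v) := by rw [← h3]
        simp only [h1, h2, if_true, if_pos e3] at e2
        linarith
    · rw [if_neg hk]; linarith
  calc _ ≤ ∑ c : Fin n → Fin n × Fin n, (∏ u, w u (c u)) *
      (∑ v, ((if S v then 1 else 0) +
        ∑ a, ∑ b, (if S b then 1 else 0) * (if H b v then 1 else 0) *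
          (if c a = (b, v) then 1 else 0)) *
        pathWeight (fun u v => forwardNext S H u (c u) v) y e v) := by
        refine Finset.sum_le_sum fun c _ => mul_le_mul_of_nonneg_left
          (Finset.sum_le_sum fun v _ => mul_le_mul_of_nonneg_right (hpt c v) (hN c v)) (hprod c)
    _ = ∑ v, (if S v then 1 else 0) * (∑ c : Fin n → Fin n × Fin n, (∏ u, w u (c u)) *
          pathWeight (fun u v => forwardNext S H u (c u) v) y e v) +
        ∑ a : Fin n, ∑ b, ∑ v, (if S b then 1 else 0) * (if H b v then 1 else 0) *
          ∑ c : Fin n → Fin n × Fin n, (∏ u, w u (c u)) *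
            ((if c a = (b, v) then 1 else 0) *
              pathWeight (fun u v => forwardNext S H u (c u) v) y e v) := by
        simp only [add_mul, Finset.sum_add_distrib, Finset.mul_sum, Finset.sum_mul, mul_add]
        congr 1
        · rw [Finset.sum_comm]
          refine Finset.sum_congr rfl fun v _ => Finset.sum_congr rfl fun c _ => ?_
          ring
        · rw [Finset.sum_comm]
          rw [Finset.sum_congr rfl fun v _ => Finset.sum_comm, Finset.sum_comm]
          refine Finset.sum_congr rfl fun a _ => ?_
          rw [Finset.sum_congr rfl fun v _ => Finset.sum_comm, Finset.sum_comm]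
          refine Finset.sum_congr rfl fun b _ => Finset.sum_congr rfl fun v _ =>
            Finset.sum_congr rfl fun c _ => ?_
          ring
    _ ≤ ∑ v, (if S v then 1 else 0) * pathWeight H (y + δ) e v +
        ∑ _a : Fin n, ∑ b, ∑ v, (if S b then 1 else 0) * (if H b v then 1 else 0) *
          (δ * pathWeight H (y + δ) e v) := by
        refine add_le_add (Finset.sum_le_sum fun v _ => mul_le_mul_of_nonneg_left (hexp v) ?_)
          (Finset.sum_le_sum fun a _ => Finset.sum_le_sum fun b _ => Finset.sum_le_sum fun v _ => ?_)
        · split_ifs <;> simp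
        · by_cases hb : S b
          · refine mul_le_mul_of_nonneg_left (hcond a b v hb) ?_
            split_ifs <;> simp
          · simp [hb]
    _ = ∑ v, (if S v then 1 else 0) * pathWeight H (y + δ) e v +
        n * (δ * ∑ b, (if S b then 1 else 0) *
          ∑ v, (if H b v then 1 else 0) * pathWeight H (y + δ) e v) := by
        rw [Finset.sum_const, Finset.card_univ, Fintype.card_fin, nsmul_eq_mul]
        congr 2
        simp only [Finset.mul_sum]
        refine Finset.sum_congr rfl fun b _ => Finset.sum_congr rfl fun v _ => ?_
        ring
    _ ≤ ∑ v, (if S v then 1 else 0) * pathWeight H (y + δ) e v +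
        n * (δ * ∑ b, (if S b then 1 else 0) * (pathWeight H (y + δ) e b / y)) := by
        gcongr with b _
        exact (sum_pathWeight_le hH hz he b).trans
          (div_le_div_of_nonneg_left (hP b) hy (by linarith))
    _ = _ := by
        simp only [← mul_div_assoc]
        rw [← Finset.sum_div]
        ring

theorem sum_distAt_mul {Γ : Type} [Fintype Γ] (step : Γ → Γ → ℝ) (g0 : Γ) (t : ℕ) (φ : Γ → ℝ) :
    ∑ g, distAt step g0 t g * φ g = (stepOp step)^[t] φ g0 := by
  induction t generalizing φ with
  | zero => simp [distAt]
  | succ t ih =>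
    rw [Function.iterate_succ_apply, ← ih]
    simp only [distAt, stepOp, Finset.sum_mul, Finset.mul_sum]
    rw [Finset.sum_comm]
    refine Finset.sum_congr rfl fun g _ => Finset.sum_congr rfl fun h _ => ?_
    ring

theorem stepOp_dirStep {n : ℕ} (φ : (Fin n → Fin n → Bool) → ℝ) (f : Fin n → Fin n → Bool) :
    stepOp dirStep φ f =
      ∑ c : Fin n → Fin n × Fin n, (∏ u, rowWeight f u (c u)) * φ (dirNext f c) := by
  simp only [stepOp, dirStep, Finset.sum_mul]
  rw [Finset.sum_comm]
  refine Finset.sum_congr rfl fun c _ => ?_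
  simp only [ite_mul, zero_mul]
  rw [Finset.sum_ite_eq Finset.univ, if_pos (Finset.mem_univ _)]
  rfl

theorem rowWeight_nonneg {V : Type} [Fintype V] [DecidableEq V] (f : V → V → Bool) (u : V)
    (x : V × V) : 0 ≤ rowWeight f u x := by
  unfold rowWeight
  split_ifs <;> positivity

theorem sum_rowWeight {V : Type} [Fintype V] [DecidableEq V] {f : V → V → Bool}
    (hf : ∀ u, 0 < outDeg f u) (u : V) : ∑ x, rowWeight f u x = 1 := by
  have h0 : ∀ v, ((outDeg f v : ℕ) : ℝ) ≠ 0 := fun v => Nat.cast_ne_zero.2 (hf v).ne'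
  simp only [rowWeight, (hf _).ne', if_false]
  rw [Fintype.sum_prod_type]
  have : ∀ v, ∑ w, (if v ∈ outN f u then
      (if w ∈ outN f v then (1 : ℝ) / ((outDeg f u : ℝ) * (outDeg f v : ℝ)) else 0) else 0) =
      if v ∈ outN f u then 1 / (outDeg f u : ℝ) else 0 := by
    intro v
    split_ifs with h
    · rw [Finset.sum_ite_mem, Finset.univ_inter, Finset.sum_const, nsmul_eq_mul]
      change (outDeg f v : ℝ) * _ = _
      have := h0 v
      have := h0 u
      field_simp
    · simp
  simp only [this]
  rw [Finset.sum_ite_mem, Finset.univ_inter, Finset.sum_const, nsmul_eq_mul]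
  exact mul_one_div_cancel (h0 u)

theorem rowWeight_le {V : Type} [Fintype V] [DecidableEq V] {f : V → V → Bool} {d : ℝ}
    (hd : 0 < d) (hf : ∀ u, d ≤ outDeg f u) (u : V) (x : V × V) :
    rowWeight f u x ≤ 1 / d ^ 2 := by
  have h0 : ∀ v, outDeg f v ≠ 0 := fun v h => by
    have := hf v; rw [h] at this; norm_num at this; linarith
  simp only [rowWeight, h0, if_false]
  split_ifs
  · rw [sq]
    exact one_div_le_one_div_of_le (by positivity)
      (mul_le_mul (hf _) (hf _) hd.le (hd.le.trans (hf _)))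
  all_goals positivity

theorem edges_of_rowWeight_ne_zero {V : Type} [Fintype V] [DecidableEq V] {f : V → V → Bool}
    (hf : ∀ u, 0 < outDeg f u) {u : V} {x : V × V} (h : rowWeight f u x ≠ 0) :
    f u x.1 = true ∧ f x.1 x.2 = true := by
  simp only [rowWeight, (hf _).ne', if_false] at h
  split_ifs at h with h1 h2
  · simpa [outN] using And.intro h1 h2
  all_goals exact absurd rfl h

theorem outDeg_le_dirNext {V : Type} [Fintype V] [DecidableEq V] (f : V → V → Bool)
    (c : V → V × V) (u : V) : outDeg f u ≤ outDeg (dirNext f c) u := by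
  refine Finset.card_le_card fun v hv => ?_
  simp only [outN, Finset.mem_filter, Finset.mem_univ, true_and] at hv
  simp [outN, dirNext, hv]

theorem dirNext_edge_of_known {n m : ℕ} {f : Fin n → Fin n → Bool} {S : Fin n → Prop}
    {H : Fin n → Fin n → Prop} (hm : ∀ u v, H u v → m ≤ u.val)
    (hf : ∀ u v, f u v = true → v.val < m ∨ S v ∨ H u v)
    {c : Fin n → Fin n × Fin n} (hc : ∀ u, f u (c u).1 = true ∧ f (c u).1 (c u).2 = true)
    (u v : Fin n) (huv : dirNext f c u v = true) :
    v.val < m ∨ knownNext S H c v ∨ forwardNext S H u (c u) v := by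
  by_cases h : f u v = true
  · rcases hf u v h with h | h | h
    · exact Or.inl h
    · exact Or.inr (Or.inl (Or.inl h))
    · exact Or.inr (Or.inr (Or.inl h))
  · simp only [dirNext, h, Bool.false_or, Bool.and_eq_true, decide_eq_true_eq] at huv
    obtain ⟨-, rfl⟩ := huv
    obtain ⟨h1, h2⟩ := hc u
    rcases hf _ _ h2 with h2 | h2 | h2
    · exact Or.inl h2
    · exact Or.inr (Or.inl (Or.inl h2))
    · by_cases hS : S (c u).1
      · exact Or.inr (Or.inl (Or.inr ⟨u, hS, h2, rfl⟩))
      · rcases hf _ _ h1 with h1 | h1 | h1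
        · exact absurd (hm _ _ h2) (not_le.2 h1)
        · exact absurd h1 hS
        · exact Or.inr (Or.inr (Or.inr ⟨hS, h1, h2, rfl⟩))

theorem le_iterate_stepOp {n m : ℕ} {d x : ℝ} (hd : 0 < d) (hx : 0 < x) {e : Fin n}
    (he : ∀ v, v ≤ e) {φ : (Fin n → Fin n → Bool) → ℝ} {s : Fin n} (hs : s.val < m)
    (hme : m ≤ e.val) (hφ0 : ∀ g, 0 ≤ φ g) (hφ : ∀ g, g s e ≠ true → φ g = 1) (k : ℕ)
    (f : Fin n → Fin n → Bool) (S : Fin n → Prop) (H : Fin n → Fin n → Prop)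
    (hdeg : ∀ u, d ≤ outDeg f u) (hH : ∀ u v, H u v → u < v) (hm : ∀ u v, H u v → m ≤ u.val)
    (hf : ∀ u v, f u v = true → v.val < m ∨ S v ∨ H u v) :
    1 - (1 + n * (1 / d ^ 2) / x) ^ k *
      ∑ v, (if S v then 1 else 0) * pathWeight H (x + k * (1 / d ^ 2)) e v ≤
        (stepOp dirStep)^[k] φ f := by
  induction k generalizing f S H with
  | zero =>
    have hP := pathWeight_nonneg hH hx.le e
    have h0 : ∀ v, 0 ≤ (if S v then 1 else 0) * pathWeight H x e v := fun v => by
      have := hP v; split_ifs <;> simp [this]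
    simp only [pow_zero, one_mul, Nat.cast_zero, zero_mul, add_zero, Function.iterate_zero, id]
    by_cases hse : f s e = true
    · have hSe : S e := by
        rcases hf _ _ hse with h | h | h
        · omega
        · exact h
        · have := hm _ _ h; omega
      have := Finset.single_le_sum (fun v (_ : v ∈ Finset.univ) => h0 v) (Finset.mem_univ e)
      rw [if_pos hSe, pathWeight_self] at this
      linarith [hφ0 f]
    · rw [hφ f hse]
      linarith [Finset.sum_nonneg fun v (_ : v ∈ Finset.univ) => h0 v]
  | succ k ih =>
    have hpos : ∀ u, 0 < outDeg f u := fun u => by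
      exact_mod_cast hd.trans_le (hdeg u)
    have hδ : 0 ≤ 1 / d ^ 2 := by positivity
    have hy : 0 < x + k * (1 / d ^ 2) := by positivity
    set C := 1 + n * (1 / d ^ 2) / x with hC
    have hC0 : 0 ≤ C := by positivity
    rw [Function.iterate_succ_apply', stepOp_dirStep]
    have hstep := sum_prod_mul_known_le (S := S) (fun u x => rowWeight_nonneg f u x)
      (sum_rowWeight hpos) hδ (rowWeight_le hd hdeg) hH hy he
    have hyk : x + k * (1 / d ^ 2) + 1 / d ^ 2 = x + (k + 1 : ℕ) * (1 / d ^ 2) := by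
      push_cast; ring
    rw [hyk] at hstep
    have hP := pathWeight_nonneg hH (y := x + (k + 1 : ℕ) * (1 / d ^ 2)) (by positivity) e
    have hCle : 1 + n * (1 / d ^ 2) / (x + k * (1 / d ^ 2)) ≤ C := by
      rw [hC]
      gcongr
      exact le_add_of_nonneg_right (by positivity)
    have hsum0 : 0 ≤ ∑ v, (if S v then 1 else 0) *
        pathWeight H (x + (k + 1 : ℕ) * (1 / d ^ 2)) e v :=
      Finset.sum_nonneg fun v _ => mul_nonneg (by split_ifs <;> simp) (hP v)
    have hstep' := hstep.trans (mul_le_mul_of_nonneg_right hCle hsum0)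
    have hone : ∑ c : Fin n → Fin n × Fin n, ∏ u, rowWeight f u (c u) = 1 := by
      rw [← Fintype.prod_sum]
      simp [sum_rowWeight hpos]
    calc _ ≤ 1 - C ^ k * ∑ c : Fin n → Fin n × Fin n, (∏ u, rowWeight f u (c u)) *
          (∑ v, (if knownNext S H c v then 1 else 0) *
            pathWeight (fun u v => forwardNext S H u (c u) v) (x + k * (1 / d ^ 2)) e v) := by
          rw [pow_succ, mul_assoc]
          exact sub_le_sub_left (mul_le_mul_of_nonneg_left hstep' (by positivity)) _
      _ = ∑ c : Fin n → Fin n × Fin n, (∏ u, rowWeight f u (c u)) *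
          (1 - C ^ k * ∑ v, (if knownNext S H c v then 1 else 0) *
            pathWeight (fun u v => forwardNext S H u (c u) v) (x + k * (1 / d ^ 2)) e v) := by
          simp only [mul_sub, mul_one, Finset.sum_sub_distrib, hone]
          congr 1
          rw [Finset.mul_sum]
          refine Finset.sum_congr rfl fun c _ => ?_
          ring
      _ ≤ _ := by
          refine Finset.sum_le_sum fun c _ => ?_
          by_cases hc : ∏ u, rowWeight f u (c u) = 0
          · simp [hc]
          · refine mul_le_mul_of_nonneg_left ?_ (Finset.prod_nonneg fun u _ =>
              rowWeight_nonneg f u _)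
            have hc' : ∀ u, f u (c u).1 = true ∧ f (c u).1 (c u).2 = true := fun u =>
              edges_of_rowWeight_ne_zero hpos (Finset.prod_ne_zero_iff.1 hc u (Finset.mem_univ u))
            refine ih _ _ _ (fun u => (hdeg u).trans ?_)
              (fun u v => forwardNext_lt hH u (c u) v) ?_ (dirNext_edge_of_known hm hf hc')
            · exact_mod_cast outDeg_le_dirNext f c u
            · rintro u v (h | ⟨_, h, _⟩)
              · exact hm _ _ h
              · exact hm _ _ h

/-- A clique on the first `m` vertices, a directed path through all vertices, and an edge from
every vertex to every vertex of the clique. -/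
def cliquePath (n m : ℕ) (u v : Fin n) : Bool :=
  decide (u ≠ v ∧ (v.val < m ∨ v.val = u.val + 1))

theorem le_outDeg_cliquePath {n m : ℕ} (hmn : m ≤ n) (u : Fin n) :
    m - 1 ≤ outDeg (cliquePath n m) u := by
  have hsub : (Finset.univ.map (Fin.castLEEmb hmn)).erase u ⊆ outN (cliquePath n m) u := by
    intro v hv
    simp only [Finset.mem_erase, Finset.mem_map, Finset.mem_univ, true_and] at hv
    obtain ⟨hne, i, rfl⟩ := hv
    simp only [outN, cliquePath, Finset.mem_filter, Finset.mem_univ, true_and,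
      decide_eq_true_eq]
    exact ⟨hne.symm, Or.inl i.2⟩
  refine le_trans ?_ (Finset.card_le_card hsub)
  refine le_trans ?_ Finset.pred_card_le_card_erase
  simp

theorem reaches_cliquePath {n m : ℕ} (hm : 0 < m) (u v : Fin n) :
    reaches (cliquePath n m) u v := by
  have hn : 0 < n := u.pos
  have h0 : reaches (cliquePath n m) u ⟨0, hn⟩ := by
    by_cases hu : u = ⟨0, hn⟩
    · rw [hu]; exact Relation.ReflTransGen.refl
    · exact Relation.ReflTransGen.single (by simp [cliquePath, hu, hm])
  have h1 : ∀ k (hk : k < n), reaches (cliquePath n m) ⟨0, hn⟩ ⟨k, hk⟩ := by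
    intro k
    induction k with
    | zero => exact fun _ => Relation.ReflTransGen.refl
    | succ k ih =>
      exact fun hk => Relation.ReflTransGen.tail (ih (by omega)) (by simp [cliquePath])
  exact h0.trans (h1 v.val v.2)

theorem pathWeight_path {n m : ℕ} (y : ℝ) (e : Fin n) (k : ℕ) (b : Fin n) (hb : m ≤ b.val)
    (hbe : b.val + k = e.val) :
    pathWeight (fun u v : Fin n => m ≤ u.val ∧ v.val = u.val + 1) y e b = y ^ k := by
  have hH : ∀ u v : Fin n, (m ≤ u.val ∧ v.val = u.val + 1) → u < v := fun u v h => by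
    rw [Fin.lt_def]; omega
  induction k generalizing b with
  | zero =>
    have : b = e := Fin.ext (by omega)
    rw [this, pathWeight_self, pow_zero]
  | succ k ih =>
    have hbe' : b ≠ e := fun h => by rw [h] at hbe; omega
    have hlt : b.val + 1 < n := by have := e.2; omega
    rw [pathWeight_of_ne hH y hbe', Finset.sum_eq_single ⟨b.val + 1, hlt⟩,
      ih _ (Nat.le_succ_of_le hb) (by simp only; omega)]
    · simp only [hb, and_self, if_true]; ring
    · intro c _ hc
      rw [if_neg fun h => hc (Fin.ext h.2), zero_mul]
    · simp

theorem half_le_not_terminated {m : ℕ} (hm : 4 ≤ m) (t : ℕ) (ht : 1024 * t ≤ (2 * m) ^ 2) :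
    (1 / 2 : ℝ) ≤ ∑ g : Fin (2 * m) → Fin (2 * m) → Bool,
      if ¬ terminated (cliquePath (2 * m) m) g then
        distAt dirStep (cliquePath (2 * m) m) t g else 0 := by
  have hmR : (4 : ℝ) ≤ m := by exact_mod_cast hm
  have htR : 1024 * (t : ℝ) ≤ (2 * m) ^ 2 := by exact_mod_cast ht
  set e : Fin (2 * m) := ⟨2 * m - 1, by omega⟩ with he
  set s : Fin (2 * m) := ⟨0, by omega⟩ with hs
  set φ : (Fin (2 * m) → Fin (2 * m) → Bool) → ℝ := fun g =>
    if ¬ terminated (cliquePath (2 * m) m) g then 1 else 0 with hφ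
  have hsum : ∑ g : Fin (2 * m) → Fin (2 * m) → Bool,
      (if ¬ terminated (cliquePath (2 * m) m) g then
        distAt dirStep (cliquePath (2 * m) m) t g else 0) =
      (stepOp dirStep)^[t] φ (cliquePath (2 * m) m) := by
    rw [← sum_distAt_mul]
    refine Finset.sum_congr rfl fun g _ => ?_
    simp [hφ]
  have hd : (0 : ℝ) < m / 2 := by positivity
  have hmain := le_iterate_stepOp (m := m) hd (x := 1 / 8) (by norm_num) (e := e) (s := s) (φ := φ)
    (fun v => by rw [Fin.le_def]; have := v.2; simp only [he]; omega)
    (by simp only [hs]; omega) (by simp only [he]; omega)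
    (fun g => by simp only [hφ]; split_ifs <;> simp)
    (fun g hg => by
      simp only [hφ]
      refine if_pos fun h => hg (h s e ?_ (reaches_cliquePath (by omega) s e))
      rw [Ne, Fin.ext_iff]; simp only [hs, he]; omega)
    t (cliquePath (2 * m) m) (fun v => v.val = m)
    (fun u v : Fin (2 * m) => m ≤ u.val ∧ v.val = u.val + 1)
    (fun u => by
      have h := le_outDeg_cliquePath (n := 2 * m) (m := m) (by omega) u
      have h' : ((m - 1 : ℕ) : ℝ) ≤ outDeg (cliquePath (2 * m) m) u := by exact_mod_cast h
      rw [Nat.cast_sub (by omega)] at h'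
      push_cast at h'
      linarith)
    (fun u v h => by rw [Fin.lt_def]; omega)
    (fun u v h => h.1)
    (fun u v h => by
      simp only [cliquePath, decide_eq_true_eq] at h
      omega)
  rw [hsum]
  refine le_trans ?_ hmain
  have hW : ∀ S : Fin (2 * m) → Prop, (∀ v, S v ↔ v.val = m) → ∑ v, (if S v then 1 else 0) *
      pathWeight (fun u v : Fin (2 * m) => m ≤ u.val ∧ v.val = u.val + 1)
        (1 / 8 + t * (1 / ((m : ℝ) / 2) ^ 2)) e v =
      (1 / 8 + t * (1 / ((m : ℝ) / 2) ^ 2)) ^ (m - 1) := by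
    intro S hS
    rw [Finset.sum_eq_single (⟨m, by omega⟩ : Fin (2 * m))]
    · rw [pathWeight_path (m := m) _ _ (m - 1) _ le_rfl (by simp only [he]; omega),
        if_pos ((hS _).2 rfl), one_mul]
    · intro c _ hc
      rw [if_neg fun h => hc (Fin.ext ((hS c).1 h)), zero_mul]
    · simp
  rw [hW _ fun _ => Iff.rfl]
  have hbase : 1 / 8 + t * (1 / ((m : ℝ) / 2) ^ 2) ≤ 1 / 4 := by
    have : t * (1 / ((m : ℝ) / 2) ^ 2) ≤ 1 / 8 := by
      rw [mul_one_div, div_le_iff₀ (by positivity)]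
      nlinarith
    linarith
  have hgrow : (1 + ((2 * m : ℕ) : ℝ) * (1 / ((m : ℝ) / 2) ^ 2) / (1 / 8)) ^ t ≤ 2 ^ m := by
    have e1 : ((2 * m : ℕ) : ℝ) * (1 / ((m : ℝ) / 2) ^ 2) / (1 / 8) = 64 / m := by
      push_cast; field_simp; norm_num
    rw [e1]
    calc (1 + 64 / (m : ℝ)) ^ t ≤ Real.exp (64 / m) ^ t := by
          gcongr
          rw [add_comm]; exact Real.add_one_le_exp _
      _ = Real.exp (t * (64 / m)) := by rw [← Real.exp_nat_mul]
      _ ≤ Real.exp (m * (1 / 4)) := by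
          refine Real.exp_le_exp.2 ?_
          rw [mul_div_assoc', div_le_iff₀ (by positivity)]
          nlinarith
      _ = Real.exp (1 / 4) ^ m := by rw [← Real.exp_nat_mul]
      _ ≤ 2 ^ m := by
          gcongr
          rw [← Real.le_log_iff_exp_le (by norm_num)]
          linarith [Real.log_two_gt_d9]
  have hfin : (2 : ℝ) ^ m * (1 / 4) ^ (m - 1) ≤ 1 / 2 := by
    obtain ⟨j, rfl⟩ : ∃ j, m = j + 3 := ⟨m - 3, by omega⟩
    have : (2 : ℝ) ^ (j + 3) * (1 / 4) ^ (j + 3 - 1) = (1 / 2) ^ j * (1 / 2) := by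
      rw [show j + 3 - 1 = j + 2 by omega, pow_add, pow_add,
        show (1 / 2 : ℝ) ^ j = (2 * (1 / 4)) ^ j by norm_num, mul_pow]
      ring
    rw [this]
    have : (1 / 2 : ℝ) ^ j ≤ 1 := pow_le_one₀ (by norm_num) (by norm_num)
    linarith
  have : (1 + ((2 * m : ℕ) : ℝ) * (1 / ((m : ℝ) / 2) ^ 2) / (1 / 8)) ^ t *
      (1 / 8 + t * (1 / ((m : ℝ) / 2) ^ 2)) ^ (m - 1) ≤ 2 ^ m * (1 / 4) ^ (m - 1) := by
    gcongr
  linarith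

/-- There are a constant `c > 0` and an integer `n₀` such that for
every even `n ≥ n₀` there is a strongly connected simple directed graph `G₀` (no
self-loops) on `n` vertices for which the expected number of rounds until the directed
two-hop process started at `G₀` terminates is at least `c·n²`.

The termination time `τ` is the least `t` with `G_t` terminated; since edges are only
ever added, termination is monotone along trajectories, so the expectation of this
stopping time is `E[τ] = ∑_{t ≥ 0} P(τ > t) = ∑_{t ≥ 0} P(G_t is not terminated)`,
which is how it is expressed below (as an extended real to allow for divergence). -/
theorem directed_twoHop_strongly_connected_lower_bound :
    ∃ c : ℝ, 0 < c ∧ ∃ n₀ : ℕ, ∀ n : ℕ, n₀ ≤ n → Even n →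
      ∃ f0 : Fin n → Fin n → Bool,
        (∀ v, f0 v v = false) ∧
        (∀ u v : Fin n, reaches f0 u v) ∧
        ENNReal.ofReal (c * (n : ℝ) ^ 2) ≤
          ∑' t : ℕ, ENNReal.ofReal
            (∑ g : Fin n → Fin n → Bool,
              if ¬ terminated f0 g then distAt dirStep f0 t g else 0) := by
  refine ⟨1 / 2048, by norm_num, 8, fun n hn heven => ?_⟩
  obtain ⟨m, rfl⟩ := heven.exists_two_nsmul
  rw [smul_eq_mul] at hn ⊢
  refine ⟨cliquePath (2 * m) m, fun v => by simp [cliquePath],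
    reaches_cliquePath (by omega), ?_⟩
  set T := (2 * m) ^ 2 / 1024 with hT
  refine le_trans ?_ (ENNReal.sum_le_tsum (Finset.range (T + 1)))
  calc ENNReal.ofReal (1 / 2048 * ((2 * m : ℕ) : ℝ) ^ 2)
      ≤ ENNReal.ofReal (∑ _t ∈ Finset.range (T + 1), 1 / 2) := by
        refine ENNReal.ofReal_le_ofReal ?_
        have h : (2 * m) ^ 2 ≤ 1024 * (T + 1) := by omega
        have h' : ((2 * m : ℕ) : ℝ) ^ 2 ≤ 1024 * (T + 1) := by exact_mod_cast h
        rw [Finset.sum_const, Finset.card_range, nsmul_eq_mul]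
        push_cast at h' ⊢
        linarith
    _ = ∑ _t ∈ Finset.range (T + 1), ENNReal.ofReal (1 / 2) :=
        ENNReal.ofReal_sum_of_nonneg fun _ _ => by norm_num
    _ ≤ _ := by
        refine Finset.sum_le_sum fun t ht => ENNReal.ofReal_le_ofReal ?_
        refine half_le_not_terminated (by omega) t ?_
        rw [Finset.mem_range] at ht
        omega
end
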